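/- arXiv:1109.5760 — 3 statements merged into one kernel-verified Lean document; each statement's English description precedes it below -/
import Mathlib

section
/- The graded algebra A is quasi-Koszul if and only if the opposite algebra A^op is quasi-Koszul. -/
open DirectSum CategoryTheory

namespace GenK

variable (k A : Type) [Field k] [Ring A] [Algebra k A] (𝒜 : ℕ → Submodule k A)

/-- The ideal `J = ⊕_{i ≥ 1} A_i`, as the left ideal generated by the
positive-degree homogeneous components. -/
noncomputable def Jideal : Ideal A :=
  Submodule.span A (⋃ i : ℕ, ((𝒜 (i + 1) : Submodule k A) : Set A))

/-- A locally finite graded module over the graded algebra `A = ⊕ 𝒜 i`. -/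
structure GMod [GradedAlgebra 𝒜] where
  M : Type
  [acg : AddCommGroup M]
  [modA : Module A M]
  [modk : Module k M]
  [tower : IsScalarTower k A M]
  gr : ℕ → Submodule k M
  [decomp : DirectSum.Decomposition gr]
  [gsmul : SetLike.GradedSMul 𝒜 gr]
  locFin : ∀ i, FiniteDimensional k (gr i)

attribute [instance] GMod.acg GMod.modA GMod.modk GMod.tower GMod.decomp GMod.gsmul

variable {k A 𝒜} [GradedAlgebra 𝒜]

/-- A graded module is generated in degree `s` if `M = A · M_s`. -/
def GMod.gen (N : GMod k A 𝒜) (s : ℕ) : Prop :=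
  Submodule.span A ((N.gr s : Submodule k N.M) : Set N.M) = ⊤

instance (N : GMod k A 𝒜) (i : ℕ) : SMul (𝒜 0) (N.gr i) :=
  ⟨fun a m => ⟨(a : A) • (m : N.M), by
    have h := SetLike.GradedSMul.smul_mem (A := 𝒜) (B := N.gr) a.2 m.2
    simpa using h⟩⟩

@[simp] lemma GMod.smul_coe (N : GMod k A 𝒜) (i : ℕ) (a : 𝒜 0) (m : N.gr i) :
    ((a • m : N.gr i) : N.M) = (a : A) • (m : N.M) := rfl

/-- The degree `i` component of a graded module is a module over `A₀ = 𝒜 0`. -/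
instance (N : GMod k A 𝒜) (i : ℕ) : Module (𝒜 0) (N.gr i) where
  one_smul m := Subtype.ext (by simp)
  mul_smul a b m := Subtype.ext (by simp [mul_smul])
  smul_zero a := Subtype.ext (by simp)
  smul_add a m n := Subtype.ext (by simp)
  add_smul a b m := Subtype.ext (by simp [add_smul])
  zero_smul m := Subtype.ext (by simp)

/-- A tower of minimal graded projective covers computing the graded syzygies
`N i = Ω^i(M₀)`, with `P i` a graded projective cover of `N i`. -/
structure SyzTower (M₀ : GMod k A 𝒜) where
  N : ℕ → GMod k A 𝒜
  zero : N 0 = M₀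
  P : ℕ → GMod k A 𝒜
  proj : ∀ i, Module.Projective A (P i).M
  p : ∀ i, (P i).M →ₗ[A] (N i).M
  surj : ∀ i, Function.Surjective (p i)
  graded : ∀ i j, ∀ x ∈ (P i).gr j, p i x ∈ (N i).gr j
  small : ∀ i (Q : Submodule A (P i).M), Q ⊔ LinearMap.ker (p i) = ⊤ → Q = ⊤
  ι : ∀ i, (N (i + 1)).M →ₗ[A] (P i).M
  inj : ∀ i, Function.Injective (ι i)
  rng : ∀ i, LinearMap.range (ι i) = LinearMap.ker (p i)
  gr_eq : ∀ i j, (N (i + 1)).gr j = ((P i).gr j).comap ((ι i).restrictScalars k)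

/-- `M` is a Koszul module: it is generated in degree 0 and has a (minimal) graded
projective resolution whose `i`-th term is generated in degree `i`. -/
def IsKoszul (M₀ : GMod k A 𝒜) : Prop :=
  M₀.gen 0 ∧ ∃ T : SyzTower M₀, ∀ i, (T.P i).gen i

end GenK

/-- `A₀ = 𝒜 0` is a self-injective algebra: every projective `A₀`-module is injective. -/
def GenK.SelfInjectiveDegZero (k A : Type) [Field k] [Ring A] [Algebra k A]
    (𝒜 : ℕ → Submodule k A) [GradedAlgebra 𝒜] : Prop :=
  ∀ (V : Type) [AddCommGroup V] [Module (𝒜 0) V],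
    Module.Projective (𝒜 0) V → Module.Injective (𝒜 0) V

/-- `M` is a quasi-Koszul `A`-module:
`Ext^1_A(A₀, A₀) · Ext^i_A(M, A₀) = Ext^{i+1}_A(M, A₀)` for all `i ≥ 0`,
the product being the Yoneda composition product; equivalently, every element of
`Ext^{i+1}_A(M, A₀)` is a sum of Yoneda products of elements of `Ext^i_A(M, A₀)` with
elements of `Ext^1_A(A₀, A₀)`.  Here `A₀` is the `A`-module `A/J`. -/
def GenK.QuasiKoszulMod (k A : Type) [Field k] [Ring A] [Algebra k A]
    (𝒜 : ℕ → Submodule k A) [CategoryTheory.HasExt.{0} (ModuleCat.{0} A)]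
    (M : Type) [AddCommGroup M] [Module A M] : Prop :=
  ∀ i : ℕ,
    AddSubgroup.closure
      { w : CategoryTheory.Abelian.Ext (ModuleCat.of A M)
            (ModuleCat.of A (A ⧸ GenK.Jideal k A 𝒜)) (i + 1) |
        ∃ (α : CategoryTheory.Abelian.Ext (ModuleCat.of A M)
            (ModuleCat.of A (A ⧸ GenK.Jideal k A 𝒜)) i)
          (β : CategoryTheory.Abelian.Ext (ModuleCat.of A (A ⧸ GenK.Jideal k A 𝒜))
            (ModuleCat.of A (A ⧸ GenK.Jideal k A 𝒜)) 1),
          w = α.comp β rfl } = ⊤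

/-- The graded algebra `A` is quasi-Koszul if `A₀` is a quasi-Koszul `A`-module. -/
def GenK.QuasiKoszulAlg (k A : Type) [Field k] [Ring A] [Algebra k A]
    (𝒜 : ℕ → Submodule k A) [CategoryTheory.HasExt.{0} (ModuleCat.{0} A)] : Prop :=
  GenK.QuasiKoszulMod k A 𝒜 (A ⧸ GenK.Jideal k A 𝒜)

namespace CategoryTheory.Abelian.Ext

open Limits

universe w v u

variable {C : Type u} [Category.{v} C] [Abelian C] [HasExt.{w} C]

/-- The self-extension algebra of `X` satisfies `E¹ · Eⁿ = Eⁿ⁺¹` for all `n`. -/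
def IsGeneratedInDegreeOne (X : C) : Prop :=
  ∀ n : ℕ, AddSubgroup.closure {w : Ext X X (n + 1) |
    ∃ (α : Ext X X n) (β : Ext X X 1), w = α.comp β rfl} = ⊤

/-- Generation in degree one does not depend on the order of the factors. -/
lemma isGeneratedInDegreeOne_iff_left (X : C) :
    IsGeneratedInDegreeOne X ↔ ∀ n : ℕ, AddSubgroup.closure {w : Ext X X (n + 1) |
      ∃ (β : Ext X X 1) (α : Ext X X n), w = β.comp α (add_comm 1 n)} = ⊤ := by
  constructor
  · intro h n
    induction n with
    | zero =>
      exact eq_top_iff.2 fun w _ ↦ AddSubgroup.subset_closure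
        ⟨w, mk₀ (𝟙 X), (comp_mk₀_id w).symm⟩
    | succ n ih =>
      rw [eq_top_iff, ← h (n + 1), AddSubgroup.closure_le]
      rintro _ ⟨α, β, rfl⟩
      have hα : α ∈ (⊤ : AddSubgroup _) := trivial
      rw [← ih] at hα
      induction hα using AddSubgroup.closure_induction with
      | mem x hx =>
        obtain ⟨β', α', rfl⟩ := hx
        exact AddSubgroup.subset_closure ⟨β', α'.comp β rfl, comp_assoc _ _ _ _ _ (by lia)⟩
      | zero => rw [zero_comp]; exact zero_mem _
      | add x y _ _ hx hy => rw [add_comp]; exact add_mem hx hy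
      | neg x _ hx => rw [neg_comp]; exact neg_mem hx
  · intro h n
    induction n with
    | zero =>
      exact eq_top_iff.2 fun w _ ↦ AddSubgroup.subset_closure
        ⟨mk₀ (𝟙 X), w, (mk₀_id_comp w).symm⟩
    | succ n ih =>
      rw [eq_top_iff, ← h (n + 1), AddSubgroup.closure_le]
      rintro _ ⟨β, α, rfl⟩
      have hα : α ∈ (⊤ : AddSubgroup _) := trivial
      rw [← ih] at hα
      induction hα using AddSubgroup.closure_induction with
      | mem x hx =>
        obtain ⟨α', β', rfl⟩ := hx
        exact AddSubgroup.subset_closure ⟨β.comp α' (add_comm 1 n), β',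
          (comp_assoc _ _ _ _ _ (by lia)).symm⟩
      | zero => rw [comp_zero]; exact zero_mem _
      | add x y _ _ hx hy => rw [comp_add]; exact add_mem hx hy
      | neg x _ hx => rw [comp_neg]; exact neg_mem hx

/-- The identity of `X` is a sum of endomorphisms factoring through `Y`. -/
def IdFactors {C : Type*} [Category C] [Preadditive C] (X Y : C) : Prop :=
  ∃ (n : ℕ) (f : Fin n → (X ⟶ Y)) (g : Fin n → (Y ⟶ X)), ∑ i, f i ≫ g i = 𝟙 X

lemma IdFactors.map {C D : Type*} [Category C] [Preadditive C] [Category D] [Preadditive D]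
    {X Y : C} (h : IdFactors X Y) (F : C ⥤ D) [F.Additive] : IdFactors (F.obj X) (F.obj Y) := by
  obtain ⟨n, f, g, hfg⟩ := h
  refine ⟨n, fun i ↦ F.map (f i), fun i ↦ F.map (g i), ?_⟩
  rw [← F.map_id, ← hfg, F.map_sum]
  simp

lemma IdFactors.of_iso {C : Type*} [Category C] [Preadditive C] {X Y : C} (e : X ≅ Y) :
    IdFactors X Y :=
  ⟨1, fun _ ↦ e.hom, fun _ ↦ e.inv, by simp⟩

lemma IsGeneratedInDegreeOne.of_idFactors {X Y : C} (hX : IsGeneratedInDegreeOne X)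
    (h : IdFactors X Y) (h' : IdFactors Y X) : IsGeneratedInDegreeOne Y := by
  obtain ⟨m, f, g, hfg⟩ := h
  obtain ⟨m', f', g', hfg'⟩ := h'
  intro n
  rw [eq_top_iff]
  rintro w -
  have hw : w = ∑ i, ∑ j, (mk₀ (f' i)).comp (((mk₀ (g' i)).comp
      (w.comp (mk₀ (f' j)) (add_zero _)) (zero_add _)).comp
        (mk₀ (g' j)) (add_zero _)) (zero_add _) := by
    have h₁ (v : Ext Y Y (n + 1)) :
        v = ∑ i, (mk₀ (f' i)).comp ((mk₀ (g' i)).comp v (zero_add _)) (zero_add _) := by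
      conv_lhs => rw [← mk₀_id_comp v, ← hfg', mk₀_sum, sum_comp]
      simp
    have h₂ (v : Ext Y Y (n + 1)) :
        v = ∑ j, (v.comp (mk₀ (f' j)) (add_zero _)).comp (mk₀ (g' j)) (add_zero _) := by
      conv_lhs => rw [← comp_mk₀_id v, ← hfg', mk₀_sum, comp_sum]
      simp
    conv_lhs => rw [h₁ w]
    refine Finset.sum_congr rfl fun i _ ↦ ?_
    conv_lhs => rw [h₂ w]
    rw [comp_sum, comp_sum]
    simp
  rw [hw]
  refine sum_mem fun i _ ↦ sum_mem fun j _ ↦ ?_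
  generalize (mk₀ (g' i)).comp (w.comp (mk₀ (f' j)) (add_zero _)) (zero_add _) = v
  have hv : v ∈ (⊤ : AddSubgroup _) := trivial
  rw [← hX n] at hv
  induction hv using AddSubgroup.closure_induction with
  | mem v hv =>
    obtain ⟨α, β, rfl⟩ := hv
    have hαβ : α.comp β rfl = ∑ l, (α.comp (mk₀ (f l)) (add_zero _)).comp
        ((mk₀ (g l)).comp β (zero_add _)) rfl := by
      conv_lhs => rw [← mk₀_id_comp β, ← hfg, mk₀_sum, sum_comp, comp_sum]
      simp
    rw [hαβ, sum_comp, comp_sum]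
    refine sum_mem fun l _ ↦ AddSubgroup.subset_closure
      ⟨(mk₀ (f' i)).comp (α.comp (mk₀ (f l)) (add_zero _)) (zero_add _),
        ((mk₀ (g l)).comp β (zero_add _)).comp (mk₀ (g' j)) (add_zero _), ?_⟩
    rw [comp_assoc_of_third_deg_zero, comp_assoc_of_third_deg_zero]
    exact (comp_assoc _ _ _ _ _ (by lia)).symm
  | zero => simp
  | add x y _ _ hx hy => rw [add_comp, comp_add]; exact add_mem hx hy
  | neg x _ hx => rw [neg_comp, comp_neg]; exact neg_mem hx

lemma comp_comp_mk₀_of_comm {X K K' L L' Z : C} {n : ℕ} (a : Ext X K n) {e : Ext K K' 1}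
    {e' : Ext L L' 1} {f : K ⟶ L} {φ : K' ⟶ L'}
    (h : e.comp (mk₀ φ) (add_zero 1) = (mk₀ f).comp e' (zero_add 1)) (g : L' ⟶ Z) :
    (a.comp e rfl).comp (mk₀ (φ ≫ g)) (add_zero (n + 1)) =
      (a.comp (mk₀ f) (add_zero n)).comp (e'.comp (mk₀ g) (add_zero 1)) rfl := by
  rw [← mk₀_comp_mk₀, ← comp_assoc_of_third_deg_zero,
    comp_assoc (a₂₃ := 1) a _ _ rfl (add_zero 1) (by lia), h,
    ← comp_assoc_of_second_deg_zero, comp_assoc_of_third_deg_zero]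

lemma mk₀_comp_comp_of_comm {X K K' L L' Z : C} {n m : ℕ} (hm : 1 + n = m) (a : Ext L' X n)
    {e : Ext K K' 1} {e' : Ext L L' 1} {f : K ⟶ L} {φ : K' ⟶ L'}
    (h : e.comp (mk₀ φ) (add_zero 1) = (mk₀ f).comp e' (zero_add 1)) (g : Z ⟶ K) :
    (mk₀ (g ≫ f)).comp (e'.comp a hm) (zero_add m) =
      ((mk₀ g).comp e (zero_add 1)).comp ((mk₀ φ).comp a (zero_add n)) hm := by
  rw [← mk₀_comp_mk₀, comp_assoc (a₂₃ := m) _ _ _ (zero_add 0) (zero_add m) (by lia),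
    ← comp_assoc (a₁₂ := 1) (mk₀ f) _ _ (zero_add 1) hm (by lia), ← h,
    comp_assoc_of_second_deg_zero, comp_assoc (a₂₃ := m) _ _ _ (zero_add 1) hm (by lia)]

lemma closure_union_eq_top_iff {G H : Type*} [AddGroup G] [AddGroup H] {f : G →+ H}
    (hf : Function.Surjective f) (U T : Set G) (hU : U = f.ker) :
    AddSubgroup.closure (U ∪ T) = ⊤ ↔ AddSubgroup.closure (f '' T) = ⊤ := by
  rw [← AddMonoidHom.map_closure, AddSubgroup.closure_union, hU, AddSubgroup.closure_eq]
  constructor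
  · intro h
    have := congrArg (AddSubgroup.map f) h
    rwa [AddSubgroup.map_sup, (AddSubgroup.map_eq_bot_iff _).2 le_rfl, bot_sup_eq,
      AddSubgroup.map_top_of_surjective _ hf] at this
  · intro h
    have := congrArg (AddSubgroup.comap f) h
    rwa [AddSubgroup.comap_map_eq, AddSubgroup.comap_top, sup_comm] at this

lemma closure_image_eq_top_iff {G H : Type*} [AddGroup G] [AddGroup H] (e : G ≃+ H) (S : Set G) :
    AddSubgroup.closure (e '' S) = ⊤ ↔ AddSubgroup.closure S = ⊤ := by
  have h := AddMonoidHom.map_closure e.toAddMonoidHom S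
  rw [AddEquiv.toAddMonoidHom_eq_coe, AddMonoidHom.coe_coe] at h
  rw [← h]
  constructor
  · intro h'
    rw [← AddSubgroup.map_top_of_surjective (e : G →+ H) e.surjective] at h'
    exact AddSubgroup.map_injective e.injective h'
  · intro h'
    rw [h', AddSubgroup.map_top_of_surjective _ e.surjective]

section Projective

/-- An iterated sequence of short exact sequences `0 ⟶ K (n + 1) ⟶ P n ⟶ K n ⟶ 0`. -/
structure SyzygyTower (C : Type u) [Category.{v} C] [Abelian C] where
  K : ℕ → C
  P : ℕ → C
  ι (n : ℕ) : K (n + 1) ⟶ P n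
  π (n : ℕ) : P n ⟶ K n
  zero (n : ℕ) : ι n ≫ π n = 0
  shortExact (n : ℕ) : (ShortComplex.mk (ι n) (π n) (zero n)).ShortExact

namespace SyzygyTower

variable (T : SyzygyTower C)

/-- The iterated extension class in `Extⁿ(K 0, K n)`. -/
noncomputable def extClass : ∀ n : ℕ, Ext (T.K 0) (T.K n) n
  | 0 => mk₀ (𝟙 _)
  | n + 1 => (extClass n).comp (T.shortExact n).extClass rfl

/-- The presentation of `Extⁿ⁺¹(K 0, Z)` by morphisms `K (n + 1) ⟶ Z`. -/
noncomputable def toExt (Z : C) (n : ℕ) : (T.K (n + 1) ⟶ Z) →+ Ext (T.K 0) Z (n + 1) :=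
  ((T.extClass (n + 1)).precomp Z (add_zero _)).comp addEquiv₀.symm.toAddMonoidHom

lemma toExt_apply {Z : C} {n : ℕ} (h : T.K (n + 1) ⟶ Z) :
    T.toExt Z n h = (T.extClass (n + 1)).comp (mk₀ h) (add_zero _) := rfl

variable [∀ n, Projective (T.P n)]

lemma exists_extClass_comp {Z : C} {n : ℕ} (w : Ext (T.K 0) Z n) (i j : ℕ) (hij : i + j = n) :
    ∃ w' : Ext (T.K i) Z j, (T.extClass i).comp w' hij = w := by
  induction i generalizing j with
  | zero =>
    obtain rfl : j = n := by lia
    exact ⟨w, by simp [extClass]⟩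
  | succ i ih =>
    obtain ⟨v, rfl⟩ := ih (j + 1) (by lia)
    obtain ⟨v', rfl⟩ := contravariant_sequence_exact₃ (T.shortExact i) _ v
      (eq_zero_of_projective _) (add_comm 1 j)
    exact ⟨v', comp_assoc _ _ _ _ _ (by lia)⟩

lemma eq_zero_of_extClass_comp {Z : C} (i j n : ℕ) (hij : i + (j + 1) = n)
    (v : Ext (T.K i) Z (j + 1)) (hv : (T.extClass i).comp v hij = 0) : v = 0 := by
  induction i generalizing j with
  | zero =>
    obtain rfl : j + 1 = n := by lia
    simpa [extClass] using hv
  | succ i ih =>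
    rw [extClass, comp_assoc _ _ _ _ (add_comm 1 (j + 1)) (by lia)] at hv
    obtain ⟨v', rfl⟩ := contravariant_sequence_exact₁ (T.shortExact i) _ v _ (ih _ _ _ hv)
    rw [eq_zero_of_projective v', comp_zero]

lemma toExt_surjective (Z : C) (n : ℕ) : Function.Surjective (T.toExt Z n) := by
  intro w
  obtain ⟨w', rfl⟩ := T.exists_extClass_comp w (n + 1) 0 (add_zero _)
  obtain ⟨h, rfl⟩ := (mk₀_bijective _ _).2 w'
  exact ⟨h, rfl⟩

lemma toExt_eq_zero_iff {Z : C} {n : ℕ} (h : T.K (n + 1) ⟶ Z) :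
    T.toExt Z n h = 0 ↔ ∃ u : T.P n ⟶ Z, T.ι n ≫ u = h := by
  rw [toExt_apply, extClass, comp_assoc _ _ _ _ (add_zero 1) (by lia)]
  constructor
  · intro hh
    obtain ⟨v, hv⟩ := contravariant_sequence_exact₁ (T.shortExact n) _ _ _
      (T.eq_zero_of_extClass_comp _ _ _ _ _ hh)
    obtain ⟨u, rfl⟩ := (mk₀_bijective _ _).2 v
    exact ⟨u, (mk₀_bijective _ _).1 (by simpa using hv)⟩
  · rintro ⟨u, rfl⟩
    have : (T.shortExact n).extClass.comp (mk₀ (T.ι n ≫ u)) (add_zero 1) = 0 := by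
      rw [← mk₀_comp_mk₀]
      exact (T.shortExact n).extClass_comp_assoc (mk₀ u)
    rw [this, comp_zero]

/-- Products of extensions, in terms of the presentation `toExt`. -/
lemma toExt_image (n : ℕ) (φ : (T.K n ⟶ T.K 0) → (T.K (n + 1) ⟶ T.K 1))
    (hφ : ∀ f, ∃ p : T.P n ⟶ T.P 0, T.ι n ≫ p = φ f ≫ T.ι 0 ∧ T.π n ≫ f = p ≫ T.π 0) :
    T.toExt (T.K 0) n '' {h | ∃ (f : T.K n ⟶ T.K 0) (g : T.K 1 ⟶ T.K 0), h = φ f ≫ g} =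
      {w | ∃ (α : Ext (T.K 0) (T.K 0) n) (β : Ext (T.K 0) (T.K 0) 1), w = α.comp β rfl} := by
  have key (f : T.K n ⟶ T.K 0) (g : T.K 1 ⟶ T.K 0) : T.toExt (T.K 0) n (φ f ≫ g) =
      ((T.extClass n).comp (mk₀ f) (add_zero n)).comp (T.toExt (T.K 0) 0 g) rfl := by
    obtain ⟨p, hp₁, hp₂⟩ := hφ f
    have nat := ShortComplex.ShortExact.extClass_naturality (T.shortExact n) (T.shortExact 0)
      { τ₁ := φ f, τ₂ := p, τ₃ := f, comm₁₂ := hp₁.symm, comm₂₃ := hp₂.symm }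
    dsimp at nat
    rw [toExt_apply, toExt_apply, extClass, extClass, extClass, mk₀_id_comp]
    exact comp_comp_mk₀_of_comm _ nat g
  ext w
  constructor
  · rintro ⟨_, ⟨f, g, rfl⟩, rfl⟩
    exact ⟨_, _, key f g⟩
  · rintro ⟨α, β, rfl⟩
    obtain ⟨g, rfl⟩ := T.toExt_surjective _ 0 β
    obtain ⟨α', rfl⟩ := T.exists_extClass_comp α n 0 (add_zero _)
    obtain ⟨f, rfl⟩ := (mk₀_bijective _ _).2 α'
    exact ⟨_, ⟨f, g, rfl⟩, key f g⟩

lemma isGeneratedInDegreeOne_iff (φ : ∀ n, (T.K n ⟶ T.K 0) → (T.K (n + 1) ⟶ T.K 1))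
    (hφ : ∀ n f, ∃ p : T.P n ⟶ T.P 0, T.ι n ≫ p = φ n f ≫ T.ι 0 ∧ T.π n ≫ f = p ≫ T.π 0) :
    IsGeneratedInDegreeOne (T.K 0) ↔ ∀ n, AddSubgroup.closure
      ({h | ∃ u : T.P n ⟶ T.K 0, T.ι n ≫ u = h} ∪
        {h | ∃ (f : T.K n ⟶ T.K 0) (g : T.K 1 ⟶ T.K 0), h = φ n f ≫ g}) = ⊤ := by
  refine forall_congr' fun n ↦ ?_
  rw [← T.toExt_image n (φ n) (hφ n)]
  refine (closure_union_eq_top_iff (T.toExt_surjective _ _) _ _ ?_).symm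
  ext h
  exact (T.toExt_eq_zero_iff h).symm

end SyzygyTower

end Projective

section Injective

/-- An iterated sequence of short exact sequences `0 ⟶ L n ⟶ I n ⟶ L (n + 1) ⟶ 0`. -/
structure CosyzygyTower (C : Type u) [Category.{v} C] [Abelian C] where
  L : ℕ → C
  I : ℕ → C
  ι (n : ℕ) : L n ⟶ I n
  π (n : ℕ) : I n ⟶ L (n + 1)
  zero (n : ℕ) : ι n ≫ π n = 0
  shortExact (n : ℕ) : (ShortComplex.mk (ι n) (π n) (zero n)).ShortExact

namespace CosyzygyTower

variable (T : CosyzygyTower C)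

/-- The iterated extension class in `Extⁿ(L n, L 0)`. -/
noncomputable def extClass : ∀ n : ℕ, Ext (T.L n) (T.L 0) n
  | 0 => mk₀ (𝟙 _)
  | n + 1 => (T.shortExact n).extClass.comp (extClass n) (add_comm 1 n)

/-- The presentation of `Extⁿ⁺¹(Z, L 0)` by morphisms `Z ⟶ L (n + 1)`. -/
noncomputable def toExt (Z : C) (n : ℕ) : (Z ⟶ T.L (n + 1)) →+ Ext Z (T.L 0) (n + 1) :=
  ((T.extClass (n + 1)).postcomp Z (zero_add _)).comp addEquiv₀.symm.toAddMonoidHom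

lemma toExt_apply {Z : C} {n : ℕ} (h : Z ⟶ T.L (n + 1)) :
    T.toExt Z n h = (mk₀ h).comp (T.extClass (n + 1)) (zero_add _) := rfl

variable [∀ n, Injective (T.I n)]

lemma exists_comp_extClass {Z : C} {n : ℕ} (w : Ext Z (T.L 0) n) (i j : ℕ) (hij : j + i = n) :
    ∃ w' : Ext Z (T.L i) j, w'.comp (T.extClass i) hij = w := by
  induction i generalizing j with
  | zero =>
    obtain rfl : j = n := by lia
    exact ⟨w, by simp [extClass]⟩
  | succ i ih =>
    obtain ⟨v, rfl⟩ := ih (j + 1) (by lia)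
    obtain ⟨v', rfl⟩ := covariant_sequence_exact₁ _ (T.shortExact i) v
      (eq_zero_of_injective _) rfl
    exact ⟨v', (comp_assoc _ _ _ _ _ (by lia)).symm⟩

lemma eq_zero_of_comp_extClass {Z : C} (i j n : ℕ) (hij : (j + 1) + i = n)
    (v : Ext Z (T.L i) (j + 1)) (hv : v.comp (T.extClass i) hij = 0) : v = 0 := by
  induction i generalizing j with
  | zero =>
    obtain rfl : j + 1 = n := by lia
    simpa [extClass] using hv
  | succ i ih =>
    rw [extClass, ← comp_assoc (a₁₂ := j + 1 + 1) _ _ _ rfl _ (by lia)] at hv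
    obtain ⟨v', rfl⟩ := covariant_sequence_exact₃ _ (T.shortExact i) v rfl (ih (j + 1) (by lia) _ hv)
    rw [eq_zero_of_injective v', zero_comp]

lemma toExt_surjective (Z : C) (n : ℕ) : Function.Surjective (T.toExt Z n) := by
  intro w
  obtain ⟨w', rfl⟩ := T.exists_comp_extClass w (n + 1) 0 (zero_add _)
  obtain ⟨h, rfl⟩ := (mk₀_bijective _ _).2 w'
  exact ⟨h, rfl⟩

lemma toExt_eq_zero_iff {Z : C} {n : ℕ} (h : Z ⟶ T.L (n + 1)) :
    T.toExt Z n h = 0 ↔ ∃ u : Z ⟶ T.I n, u ≫ T.π n = h := by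
  rw [toExt_apply, extClass, ← comp_assoc (a₁₂ := 1) _ _ _ (zero_add 1) _ (by lia)]
  constructor
  · intro hh
    obtain ⟨v, hv⟩ := covariant_sequence_exact₃ _ (T.shortExact n) _ _
      (T.eq_zero_of_comp_extClass n 0 (n + 1) (by lia) _ hh)
    obtain ⟨u, rfl⟩ := (mk₀_bijective _ _).2 v
    exact ⟨u, (mk₀_bijective _ _).1 (by simpa using hv)⟩
  · rintro ⟨u, rfl⟩
    have : (mk₀ (u ≫ T.π n)).comp (T.shortExact n).extClass (zero_add 1) = 0 := by
      rw [← mk₀_comp_mk₀, comp_assoc_of_second_deg_zero]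
      exact (congrArg (fun t ↦ (mk₀ u).comp t _) (T.shortExact n).comp_extClass).trans
        (comp_zero _ _ _ _ _)
    rw [this, zero_comp]

/-- Products of extensions, in terms of the presentation `toExt`. -/
lemma toExt_image (n : ℕ) (φ : (T.L 0 ⟶ T.L n) → (T.L 1 ⟶ T.L (n + 1)))
    (hφ : ∀ f, ∃ p : T.I 0 ⟶ T.I n, T.π 0 ≫ φ f = p ≫ T.π n ∧ f ≫ T.ι n = T.ι 0 ≫ p) :
    T.toExt (T.L 0) n '' {h | ∃ (f : T.L 0 ⟶ T.L n) (g : T.L 0 ⟶ T.L 1), h = g ≫ φ f} =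
      {w | ∃ (β : Ext (T.L 0) (T.L 0) 1) (α : Ext (T.L 0) (T.L 0) n),
        w = β.comp α (add_comm 1 n)} := by
  have key (f : T.L 0 ⟶ T.L n) (g : T.L 0 ⟶ T.L 1) : T.toExt (T.L 0) n (g ≫ φ f) =
      (T.toExt (T.L 0) 0 g).comp ((mk₀ f).comp (T.extClass n) (zero_add n)) (add_comm 1 n) := by
    obtain ⟨p, hp₁, hp₂⟩ := hφ f
    have nat := ShortComplex.ShortExact.extClass_naturality (T.shortExact 0) (T.shortExact n)
      { τ₁ := f, τ₂ := p, τ₃ := φ f, comm₁₂ := hp₂, comm₂₃ := hp₁.symm }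
    dsimp at nat
    rw [toExt_apply, toExt_apply, extClass, extClass, extClass, comp_mk₀_id]
    exact mk₀_comp_comp_of_comm _ _ nat g
  ext w
  constructor
  · rintro ⟨_, ⟨f, g, rfl⟩, rfl⟩
    exact ⟨_, _, key f g⟩
  · rintro ⟨β, α, rfl⟩
    obtain ⟨g, rfl⟩ := T.toExt_surjective _ 0 β
    obtain ⟨α', rfl⟩ := T.exists_comp_extClass α n 0 (zero_add _)
    obtain ⟨f, rfl⟩ := (mk₀_bijective _ _).2 α'
    exact ⟨_, ⟨f, g, rfl⟩, key f g⟩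

lemma isGeneratedInDegreeOne_iff (φ : ∀ n, (T.L 0 ⟶ T.L n) → (T.L 1 ⟶ T.L (n + 1)))
    (hφ : ∀ n f, ∃ p : T.I 0 ⟶ T.I n, T.π 0 ≫ φ n f = p ≫ T.π n ∧ f ≫ T.ι n = T.ι 0 ≫ p) :
    IsGeneratedInDegreeOne (T.L 0) ↔ ∀ n, AddSubgroup.closure
      ({h | ∃ u : T.L 0 ⟶ T.I n, u ≫ T.π n = h} ∪
        {h | ∃ (f : T.L 0 ⟶ T.L n) (g : T.L 0 ⟶ T.L 1), h = g ≫ φ n f}) = ⊤ := by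
  rw [isGeneratedInDegreeOne_iff_left]
  refine forall_congr' fun n ↦ ?_
  rw [← T.toExt_image n (φ n) (hφ n)]
  refine (closure_union_eq_top_iff (T.toExt_surjective _ _) _ _ ?_).symm
  ext h
  exact (T.toExt_eq_zero_iff h).symm

end CosyzygyTower

end Injective

namespace SyzygyTower

/-- The syzygies of `X` with respect to chosen projective presentations. -/
noncomputable def syzygy [EnoughProjectives C] (X : C) : ℕ → C
  | 0 => X
  | n + 1 => kernel (Projective.π (syzygy X n))

/-- The tower of syzygies of `X`. -/
noncomputable def ofEnoughProjectives [EnoughProjectives C] (X : C) : SyzygyTower C where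
  K := syzygy X
  P n := Projective.over (syzygy X n)
  ι _ := kernel.ι _
  π _ := Projective.π _
  zero _ := kernel.condition _
  shortExact _ :=
    { exact := ShortComplex.exact_of_f_is_kernel _ (kernelIsKernel _)
      mono_f := inferInstanceAs (Mono (kernel.ι _))
      epi_g := inferInstanceAs (Epi (Projective.π _)) }

instance [EnoughProjectives C] (X : C) (n : ℕ) : Projective ((ofEnoughProjectives X).P n) :=
  Projective.projective_over _

omit [HasExt.{w} C] in
lemma exists_lift (T : SyzygyTower C) [∀ n, Projective (T.P n)] (n : ℕ) (f : T.K n ⟶ T.K 0) :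
    ∃ (φ : T.K (n + 1) ⟶ T.K 1) (p : T.P n ⟶ T.P 0),
      T.ι n ≫ p = φ ≫ T.ι 0 ∧ T.π n ≫ f = p ≫ T.π 0 := by
  have := (T.shortExact 0).epi_g
  have := (T.shortExact 0).mono_f
  dsimp at *
  let p := Projective.factorThru (T.π n ≫ f) (T.π 0)
  have hp : p ≫ T.π 0 = T.π n ≫ f := Projective.factorThru_comp _ _
  have h0 : (T.ι n ≫ p) ≫ T.π 0 = 0 := by
    rw [Category.assoc, hp, ← Category.assoc, T.zero, Limits.zero_comp]
  exact ⟨(T.shortExact 0).exact.lift (T.ι n ≫ p) h0, p,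
    ((T.shortExact 0).exact.lift_f (T.ι n ≫ p) h0).symm, hp.symm⟩

variable {B : Type*} [Category B] [Abelian B]

/-- The image of a syzygy tower under an exact contravariant functor. -/
@[simps]
def map (T : SyzygyTower C) (D : Cᵒᵖ ⥤ B) [D.PreservesZeroMorphisms]
    (hD : ∀ S : ShortComplex C, S.ShortExact → (S.op.map D).ShortExact) : CosyzygyTower B where
  L n := D.obj (.op (T.K n))
  I n := D.obj (.op (T.P n))
  ι n := D.map (T.π n).op
  π n := D.map (T.ι n).op
  zero n := by rw [← D.map_comp, ← op_comp, T.zero, op_zero, D.map_zero]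
  shortExact n := hD _ (T.shortExact n)

lemma isGeneratedInDegreeOne_op_map_iff (T : SyzygyTower C) [∀ n, Projective (T.P n)]
    [HasExt.{w} B] (D : Cᵒᵖ ⥤ B) [D.Additive]
    (hD : ∀ S : ShortComplex C, S.ShortExact → (S.op.map D).ShortExact)
    (hI : ∀ P : C, Projective P → Injective (D.obj (.op P)))
    (hX : ∀ K : C, Function.Bijective
      (fun f : K ⟶ T.K 0 ↦ (D.map f.op : D.obj (.op (T.K 0)) ⟶ D.obj (.op K)))) :
    IsGeneratedInDegreeOne (T.K 0) ↔ IsGeneratedInDegreeOne (D.obj (.op (T.K 0))) := by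
  have (n : ℕ) : Injective ((T.map D hD).I n) := hI _ inferInstance
  choose φ p hp₁ hp₂ using T.exists_lift
  let E (K : C) : (K ⟶ T.K 0) ≃+ (D.obj (.op (T.K 0)) ⟶ D.obj (.op K)) :=
    { Equiv.ofBijective _ (hX K) with map_add' := fun f g ↦ by simp }
  have hE (K : C) (f : K ⟶ T.K 0) : E K f = D.map f.op := rfl
  have hE' (K : C) (f : D.obj (.op (T.K 0)) ⟶ D.obj (.op K)) :
      D.map ((E K).symm f).op = f := (E K).apply_symm_apply f
  refine (T.isGeneratedInDegreeOne_iff φ fun n f ↦ ⟨p n f, hp₁ n f, hp₂ n f⟩).trans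
    (Iff.trans ?_ ((T.map D hD).isGeneratedInDegreeOne_iff
      (fun n f ↦ D.map (φ n ((E (T.K n)).symm f)).op) ?_).symm)
  · refine forall_congr' fun n ↦ ?_
    rw [← closure_image_eq_top_iff (E (T.K (n + 1))), Set.image_union]
    refine Eq.to_iff (congrArg (fun S ↦ AddSubgroup.closure S = ⊤) (congrArg₂ _ ?_ ?_))
    · ext h
      constructor
      · rintro ⟨_, ⟨u, rfl⟩, rfl⟩
        exact ⟨D.map u.op, by rw [hE, op_comp, D.map_comp]; rfl⟩
      · rintro ⟨u, rfl⟩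
        refine ⟨_, ⟨(E (T.P n)).symm u, rfl⟩, ?_⟩
        rw [hE, op_comp, D.map_comp]
        exact congrArg (· ≫ _) (hE' _ _)
    · ext h
      constructor
      · rintro ⟨_, ⟨f, g, rfl⟩, rfl⟩
        exact ⟨D.map f.op, D.map g.op, by
          rw [hE, op_comp, D.map_comp, ← hE _ f, AddEquiv.symm_apply_apply]; rfl⟩
      · rintro ⟨f, g, rfl⟩
        refine ⟨_, ⟨(E _).symm f, (E _).symm g, rfl⟩, ?_⟩
        rw [hE, op_comp, D.map_comp]
        exact congrArg (· ≫ _) (hE' _ _)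
  · intro n f
    refine ⟨D.map (p n ((E (T.K n)).symm f)).op, ?_, ?_⟩
    · change D.map _ ≫ D.map _ = D.map _ ≫ D.map _
      rw [← D.map_comp, ← op_comp, ← hp₁, op_comp, D.map_comp]
    · change f ≫ D.map _ = D.map _ ≫ D.map _
      rw [← D.map_comp, ← op_comp, ← hp₂, op_comp, D.map_comp]
      exact congrArg (· ≫ _) (hE' _ _).symm

end SyzygyTower

/-- An exact contravariant functor sending projectives to injectives and fully faithful on
morphisms to `X` preserves and reflects generation in degree one of the self-extensions of `X`. -/
theorem isGeneratedInDegreeOne_op_map_iff [EnoughProjectives C] {B : Type*} [Category B]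
    [Abelian B] [HasExt.{w} B] (D : Cᵒᵖ ⥤ B) [D.Additive]
    (hD : ∀ S : ShortComplex C, S.ShortExact → (S.op.map D).ShortExact)
    (hI : ∀ P : C, Projective P → Injective (D.obj (.op P))) (X : C)
    (hX : ∀ K : C, Function.Bijective
      (fun f : K ⟶ X ↦ (D.map f.op : D.obj (.op X) ⟶ D.obj (.op K)))) :
    IsGeneratedInDegreeOne X ↔ IsGeneratedInDegreeOne (D.obj (.op X)) :=
  (SyzygyTower.ofEnoughProjectives X).isGeneratedInDegreeOne_op_map_iff D hD hI hX

end CategoryTheory.Abelian.Ext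

section SelfInjective

universe u

variable {R : Type u} [Ring R]

/-- A maximal left ideal containing a finite intersection of maximal left ideals has quotient
isomorphic to one of theirs. -/
lemma Ideal.exists_quotient_equiv_of_inf_le {ι : Type*} (s : Finset ι) (I : ι → Ideal R)
    (hI : ∀ i, (I i).IsMaximal) (m : Ideal R) [hm : m.IsMaximal] (h : s.inf I ≤ m) :
    ∃ i ∈ s, Nonempty ((R ⧸ I i) ≃ₗ[R] R ⧸ m) := by
  classical
  induction s using Finset.induction_on with
  | empty => exact (hm.ne_top (top_le_iff.1 h)).elim
  | insert a s _ ih =>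
    by_cases hs : s.inf I ≤ m
    · obtain ⟨i, hi, e⟩ := ih hs
      exact ⟨i, Finset.mem_insert_of_mem hi, e⟩
    obtain ⟨l, hl, hlm⟩ := SetLike.not_le_iff_exists.1 hs
    rw [Finset.inf_insert] at h
    have hla : l ∉ I a := fun hla ↦ hlm (h ⟨hla, hl⟩)
    have : IsSimpleModule R (R ⧸ I a) := isSimpleModule_iff_isCoatom.2 (hI a).out
    have : IsSimpleModule R (R ⧸ m) := isSimpleModule_iff_isCoatom.2 hm.out
    have ha : (I a).mkQ l ≠ 0 := by simpa using hla
    have hm0 : m.mkQ l ≠ 0 := by simpa using hlm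
    have hle : LinearMap.ker (LinearMap.toSpanSingleton R _ ((I a).mkQ l)) ≤
        LinearMap.ker (LinearMap.toSpanSingleton R _ (m.mkQ l)) := by
      intro r hr
      rw [LinearMap.mem_ker, LinearMap.toSpanSingleton_apply, ← map_smul, Submodule.mkQ_apply,
        Submodule.Quotient.mk_eq_zero] at hr ⊢
      exact h ⟨hr, Submodule.smul_mem _ r hl⟩
    have heq := (IsSimpleModule.ker_toSpanSingleton_isMaximal R ha).eq_of_le
      (IsSimpleModule.ker_toSpanSingleton_isMaximal R hm0).ne_top hle
    exact ⟨a, Finset.mem_insert_self _ _,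
      ⟨(LinearMap.quotKerEquivOfSurjective _
          (IsSimpleModule.toSpanSingleton_surjective R ha)).symm ≪≫ₗ
        Submodule.quotEquivOfEq _ _ heq ≪≫ₗ (LinearMap.quotKerEquivOfSurjective _
          (IsSimpleModule.toSpanSingleton_surjective R hm0))⟩⟩

/-- Over a left artinian ring, a simple module is determined by its annihilator. -/
lemma Ideal.quotient_equiv_of_annihilator_le [IsArtinianRing R] (m m' : Ideal R) [m.IsMaximal]
    [m'.IsMaximal] (h : Module.annihilator R (R ⧸ m) ≤ m') :
    Nonempty ((R ⧸ m) ≃ₗ[R] R ⧸ m') := by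
  have : IsSimpleModule R (R ⧸ m) := isSimpleModule_iff_isCoatom.2 (Ideal.IsMaximal.out)
  let I (t : {t : R ⧸ m // t ≠ 0}) : Ideal R := LinearMap.ker (LinearMap.toSpanSingleton R _ t.1)
  obtain ⟨s, hs⟩ := Finset.exists_inf_le I
  have hle : s.inf I ≤ m' := fun r hr ↦ h <| Module.mem_annihilator.2 fun t ↦ by
    by_cases ht : t = 0
    · rw [ht, smul_zero]
    · exact hs ⟨t, ht⟩ hr
  obtain ⟨t, -, ⟨e⟩⟩ := exists_quotient_equiv_of_inf_le s I
    (fun t ↦ IsSimpleModule.ker_toSpanSingleton_isMaximal R t.2) m' hle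
  exact ⟨(LinearMap.quotKerEquivOfSurjective _
    (IsSimpleModule.toSpanSingleton_surjective R t.2)).symm ≪≫ₗ e⟩

/-- Isomorphism of the simple quotients by maximal left ideals. -/
def maximalIdealSetoid (R : Type u) [Ring R] : Setoid {m : Ideal R // m.IsMaximal} where
  r m m' := Nonempty ((R ⧸ m.1) ≃ₗ[R] R ⧸ m'.1)
  iseqv :=
    { refl := fun _ ↦ ⟨.refl _ _⟩
      symm := fun ⟨e⟩ ↦ ⟨e.symm⟩
      trans := fun ⟨e⟩ ⟨f⟩ ↦ ⟨e ≪≫ₗ f⟩ }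

/-- A left artinian ring has finitely many simple modules up to isomorphism. -/
lemma finite_quotient_maximalIdealSetoid (R : Type u) [Ring R] [IsArtinianRing R] :
    Finite (Quotient (maximalIdealSetoid R)) := by
  obtain ⟨s, hs⟩ := Finset.exists_inf_le (Subtype.val (p := fun m : Ideal R ↦ m.IsMaximal))
  refine Finite.of_surjective (fun m : s ↦ (Quotient.mk (maximalIdealSetoid R) m.1)) fun q ↦ ?_
  obtain ⟨m, rfl⟩ := Quotient.exists_rep q
  have := m.2
  obtain ⟨i, hi, e⟩ := Ideal.exists_quotient_equiv_of_inf_le s _ (fun i ↦ i.2) m.1 (hs m)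
  exact ⟨⟨i, hi⟩, Quotient.sound e⟩

variable (k : Type*) [Field k] [Algebra k R] [Module.Finite k R]

include k in
/-- In a left self-injective finite-dimensional algebra, proper right ideals have nonzero left
annihilator. -/
lemma Module.Injective.exists_ne_zero_mul_eq_zero [Module.Injective R R] (P : Submodule k R)
    (hP : ∀ p ∈ P, ∀ r, p * r ∈ P) (h1 : (1 : R) ∉ P) : ∃ x : R, x ≠ 0 ∧ ∀ p ∈ P, x * p = 0 := by
  classical
  obtain ⟨s, hs⟩ := IsNoetherian.noetherian P
  let φ : R →ₗ[R] (s → R) := LinearMap.pi fun p ↦ LinearMap.toSpanSingleton R R p.1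
  by_cases hφ : Function.Injective φ
  · exfalso
    obtain ⟨h, hh⟩ := Module.Injective.out φ hφ LinearMap.id
    apply h1
    have := hh 1
    rw [LinearMap.pi_apply_eq_sum_univ h] at this
    rw [LinearMap.id_apply] at this
    rw [← this]
    refine Submodule.sum_mem _ fun i _ ↦ ?_
    rw [smul_eq_mul]
    refine hP _ ?_ _
    have : φ 1 i = i.1 := by simp [φ]
    rw [this, ← hs]
    exact Submodule.subset_span i.2
  · rw [← LinearMap.ker_eq_bot, Submodule.eq_bot_iff] at hφ
    push Not at hφ
    obtain ⟨x, hx, hx0⟩ := hφ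
    refine ⟨x, hx0, fun p hp ↦ ?_⟩
    rw [← hs] at hp
    induction hp using Submodule.span_induction with
    | mem p hp => simpa [φ] using congrFun hx ⟨p, hp⟩
    | zero => exact mul_zero x
    | add a b _ _ ha hb => rw [mul_add, ha, hb, add_zero]
    | smul c a _ ha => rw [mul_smul_comm, ha, smul_zero]

include k in
lemma Module.Injective.exists_simple_embedding [Module.Injective R R] (m : Ideal R)
    [hm : m.IsMaximal] : ∃ (m' : Ideal R) (_ : m'.IsMaximal) (f : (R ⧸ m') →ₗ[R] R),
      Function.Injective f ∧ ∀ t, ∀ p ∈ Module.annihilator R (R ⧸ m), f t * p = 0 := by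
  have : IsArtinianRing R := IsArtinianRing.of_finite k R
  have hm1 : (1 : R) ∉ Module.annihilator R (R ⧸ m) := fun h1 ↦ hm.ne_top <|
    (Ideal.eq_top_iff_one m).2 <| by
      simpa using Module.mem_annihilator.1 h1 (m.mkQ 1)
  obtain ⟨x, hx0, hx⟩ := Module.Injective.exists_ne_zero_mul_eq_zero k
    ((Module.annihilator R (R ⧸ m)).restrictScalars k)
    (fun p hp r ↦ Module.mem_annihilator.2 fun t ↦ by
      rw [mul_smul]; exact Module.mem_annihilator.1 hp _) hm1
  let L : Ideal R :=
    { carrier := {y | ∀ p ∈ Module.annihilator R (R ⧸ m), y * p = 0}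
      add_mem' := fun {a b} ha hb p hp ↦ by rw [add_mul, ha p hp, hb p hp, add_zero]
      zero_mem' := fun p _ ↦ zero_mul p
      smul_mem' := fun c y hy p hp ↦ by rw [smul_eq_mul, mul_assoc, hy p hp, mul_zero] }
  obtain h | ⟨N, hN, hNL⟩ := eq_bot_or_exists_atom_le L
  · exact (hx0 ((Submodule.eq_bot_iff _).1 h x hx)).elim
  have := isSimpleModule_iff_isAtom.2 hN
  obtain ⟨m', hm', ⟨e⟩⟩ := isSimpleModule_iff_quot_maximal.1 this
  exact ⟨m', hm', N.subtype ∘ₗ e.symm.toLinearMap,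
    N.subtype_injective.comp e.symm.injective, fun t p hp ↦ hNL (e.symm t).2 p hp⟩

lemma Module.Injective.equiv_of_simple_embedding [IsArtinianRing R] [Module.Injective R R]
    (m₁ m₂ m' : Ideal R) [m₁.IsMaximal] [m₂.IsMaximal] [hm' : m'.IsMaximal]
    (f₁ f₂ : (R ⧸ m') →ₗ[R] R) (hf₁ : Function.Injective f₁) (hf₂ : Function.Injective f₂)
    (h₁ : ∀ t, ∀ p ∈ Module.annihilator R (R ⧸ m₁), f₁ t * p = 0)
    (h₂ : ∀ t, ∀ p ∈ Module.annihilator R (R ⧸ m₂), f₂ t * p = 0) :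
    Nonempty ((R ⧸ m₁) ≃ₗ[R] R ⧸ m₂) := by
  obtain ⟨h, hh⟩ := Module.Injective.out f₁ hf₁ f₂
  have key (t) : f₂ t = f₁ t * h 1 := by
    rw [← hh, ← smul_eq_mul, ← map_smul, smul_eq_mul, mul_one]
  have : IsSimpleModule R (R ⧸ m') := isSimpleModule_iff_isCoatom.2 hm'.out
  have := IsSimpleModule.nontrivial R (R ⧸ m')
  obtain ⟨t, ht⟩ := exists_ne (0 : R ⧸ m')
  have hne : Module.annihilator R (R ⧸ m₁) ⊔ Module.annihilator R (R ⧸ m₂) ≠ ⊤ := by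
    intro htop
    obtain ⟨a, ha, b, hb, hab⟩ := Submodule.mem_sup.1 ((Ideal.eq_top_iff_one _).1 htop)
    apply ht
    apply hf₂
    rw [map_zero, ← mul_one (f₂ t), ← hab, mul_add, h₂ t b hb, add_zero, key, mul_assoc]
    refine h₁ t _ (Module.mem_annihilator.2 fun z ↦ ?_)
    rw [mul_smul, Module.mem_annihilator.1 ha, smul_zero]
  obtain ⟨m, hm, hle⟩ := Ideal.exists_le_maximal _ hne
  obtain ⟨e₁⟩ := Ideal.quotient_equiv_of_annihilator_le m₁ m (le_sup_left.trans hle)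
  obtain ⟨e₂⟩ := Ideal.quotient_equiv_of_annihilator_le m₂ m (le_sup_right.trans hle)
  exact ⟨e₁ ≪≫ₗ e₂.symm⟩

include k in
/-- Every simple module over a left self-injective finite-dimensional algebra embeds in the
algebra. -/
lemma Module.Injective.exists_injective_of_isMaximal [Module.Injective R R] (m : Ideal R)
    [hm : m.IsMaximal] : ∃ f : (R ⧸ m) →ₗ[R] R, Function.Injective f := by
  have : IsArtinianRing R := IsArtinianRing.of_finite k R
  have := finite_quotient_maximalIdealSetoid R
  choose g hg f hf hfp using fun (m : Ideal R) (_ : m.IsMaximal) ↦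
    Module.Injective.exists_simple_embedding k m
  have key (m₁ m₂ : Ideal R) (h₁ : m₁.IsMaximal) (h₂ : m₂.IsMaximal)
      (e : (R ⧸ g m₁ h₁) ≃ₗ[R] R ⧸ g m₂ h₂) : Nonempty ((R ⧸ m₁) ≃ₗ[R] R ⧸ m₂) := by
    have := hg m₁ h₁
    exact Module.Injective.equiv_of_simple_embedding m₁ m₂ (g m₁ h₁) (f m₁ h₁)
      (f m₂ h₂ ∘ₗ e.toLinearMap) (hf m₁ h₁) ((hf m₂ h₂).comp e.injective) (hfp m₁ h₁)
      fun t ↦ hfp m₂ h₂ (e t)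
  let F (q : Quotient (maximalIdealSetoid R)) : Quotient (maximalIdealSetoid R) :=
    Quotient.mk _ ⟨g q.out.1 q.out.2, hg _ _⟩
  have hF : Function.Injective F := by
    intro q q' h
    obtain ⟨e⟩ := Quotient.exact h
    rw [← Quotient.out_eq q, ← Quotient.out_eq q']
    exact Quotient.sound (key _ _ _ _ e)
  obtain ⟨q, hq⟩ := Finite.surjective_of_injective hF (Quotient.mk _ ⟨m, hm⟩)
  obtain ⟨e⟩ := Quotient.exact hq
  have hinj := hf _ q.out.2
  exact ⟨f q.out.1 q.out.2 ∘ₗ e.symm.toLinearMap, hinj.comp e.symm.injective⟩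

include k in
/-- A left self-injective finite-dimensional algebra is a cogenerator. -/
lemma Module.Injective.exists_apply_ne_zero [Module.Injective R R] {M : Type u} [AddCommGroup M]
    [Module R M] {x : M} (hx : x ≠ 0) : ∃ f : M →ₗ[R] R, f x ≠ 0 := by
  have hne : LinearMap.ker (LinearMap.toSpanSingleton R M x) ≠ ⊤ := fun h ↦ hx <| by
    simpa using (Ideal.eq_top_iff_one _).1 h
  obtain ⟨m, hm, hle⟩ := Ideal.exists_le_maximal _ hne
  obtain ⟨f, hf⟩ := Module.Injective.exists_injective_of_isMaximal k m
  obtain ⟨h, hh⟩ := Module.Injective.out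
    ((LinearMap.ker (LinearMap.toSpanSingleton R M x)).liftQ _ le_rfl)
    (LinearMap.ker_eq_bot.1 (Submodule.ker_liftQ_eq_bot _ _ _ le_rfl))
    (f ∘ₗ (LinearMap.ker (LinearMap.toSpanSingleton R M x)).liftQ m.mkQ
      (by rwa [Submodule.ker_mkQ]))
  refine ⟨h, fun h0 ↦ ?_⟩
  have := hh (Submodule.Quotient.mk 1)
  rw [Submodule.liftQ_apply, LinearMap.toSpanSingleton_apply, one_smul, h0] at this
  have h1 := hf ((map_zero f).trans this)
  rw [Submodule.liftQ_apply] at h1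
  exact hm.ne_top ((Ideal.eq_top_iff_one m).2 ((Submodule.Quotient.mk_eq_zero m).1 h1.symm))

end SelfInjective

section OpDual

universe u

open MulOpposite

/-- The `k`-linear dual of a right `A`-module, regarded as a left `A`-module. -/
def OpDual (k M : Type*) [Field k] [AddCommGroup M] [Module k M] : Type _ := M →ₗ[k] k

namespace OpDual

variable {k A M N : Type*} [Field k] [Ring A] [Algebra k A] [AddCommGroup M] [Module k M]
  [Module Aᵐᵒᵖ M] [IsScalarTower k Aᵐᵒᵖ M] [AddCommGroup N] [Module k N]
  [Module Aᵐᵒᵖ N] [IsScalarTower k Aᵐᵒᵖ N]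

instance : AddCommGroup (OpDual k M) := inferInstanceAs (AddCommGroup (M →ₗ[k] k))

instance : Module k (OpDual k M) := inferInstanceAs (Module k (M →ₗ[k] k))

instance [Module.Finite k M] : Module.Finite k (OpDual k M) :=
  inferInstanceAs (Module.Finite k (Module.Dual k M))

instance : FunLike (OpDual k M) M k := inferInstanceAs (FunLike (M →ₗ[k] k) M k)

instance : LinearMapClass (OpDual k M) k M k :=
  inferInstanceAs (LinearMapClass (M →ₗ[k] k) k M k)

@[ext] lemma ext {φ ψ : OpDual k M} (h : ∀ m, φ m = ψ m) : φ = ψ := LinearMap.ext h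

@[simp] lemma add_apply (φ ψ : OpDual k M) (m : M) : (φ + ψ) m = φ m + ψ m := rfl

@[simp] lemma zero_apply (m : M) : (0 : OpDual k M) m = 0 := rfl

/-- Bundle a linear functional as an element of `OpDual`. -/
def mk (φ : M →ₗ[k] k) : OpDual k M := φ

@[simp] lemma mk_apply (φ : M →ₗ[k] k) (m : M) : mk φ m = φ m := rfl

lemma op_smul_smul (a : A) (c : k) (m : M) : op a • c • m = c • op a • m := by
  rw [← smul_one_smul Aᵐᵒᵖ c m, smul_smul, ← smul_assoc, mul_smul_comm, mul_one]

instance : SMul A (OpDual k M) where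
  smul a φ :=
    mk { toFun := fun m ↦ φ (op a • m)
         map_add' := fun m n ↦ by rw [smul_add, map_add]
         map_smul' := fun c m ↦ by rw [op_smul_smul, map_smul]; rfl }

@[simp] lemma smul_apply (a : A) (φ : OpDual k M) (m : M) : (a • φ) m = φ (op a • m) := rfl

instance : Module A (OpDual k M) where
  one_smul φ := by ext; simp
  mul_smul a b φ := by ext; simp [mul_smul]
  smul_zero a := by ext; simp
  smul_add a φ ψ := by ext; simp
  add_smul a b φ := by ext; simp [add_smul]
  zero_smul φ := by ext; simp

lemma smul_apply' (c : k) (φ : OpDual k M) (m : M) : (c • φ) m = c • φ m := rfl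

instance : IsScalarTower k A (OpDual k M) where
  smul_assoc c a φ := by
    ext m
    rw [smul_apply', smul_apply, smul_apply, op_smul, smul_assoc, map_smul]

lemma map_aux (f : M →ₗ[Aᵐᵒᵖ] N) (c : k) (m : M) : f (c • m) = c • f m := by
  rw [← smul_one_smul Aᵐᵒᵖ c m, map_smul, smul_one_smul]

/-- Functoriality of `OpDual`. -/
def map (f : M →ₗ[Aᵐᵒᵖ] N) : OpDual k N →ₗ[A] OpDual k M where
  toFun φ := mk { toFun := fun m ↦ φ (f m)
                  map_add' := fun m n ↦ by rw [map_add, map_add]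
                  map_smul' := fun c m ↦ by rw [map_aux, map_smul]; rfl }
  map_add' _ _ := rfl
  map_smul' a φ := by
    ext m
    simp

@[simp] lemma map_apply (f : M →ₗ[Aᵐᵒᵖ] N) (φ : OpDual k N) (m : M) :
    map f φ m = φ (f m) := rfl

lemma eq_of_forall_apply {m n : M} (h : ∀ φ : OpDual k M, φ m = φ n) : m = n := by
  rw [← sub_eq_zero, ← Module.forall_dual_apply_eq_zero_iff k]
  intro φ
  rw [map_sub, sub_eq_zero]
  exact h φ

lemma map_bijective [Module.Finite k N] :
    Function.Bijective (map : (M →ₗ[Aᵐᵒᵖ] N) → (OpDual k N →ₗ[A] OpDual k M)) := by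
  constructor
  · intro f g h
    ext m
    exact eq_of_forall_apply (k := k) fun φ ↦
      congrFun (congrArg DFunLike.coe (LinearMap.congr_fun h φ)) m
  · intro h
    have hsmul (c : k) (φ : OpDual k N) : h (c • φ) = c • h φ := by
      rw [← smul_one_smul A c φ, map_smul, smul_one_smul]
    have key (m : M) : ∃ n : N, ∀ φ : OpDual k N, φ n = h φ m := by
      let ev : Module.Dual k (Module.Dual k N) :=
        { toFun := fun φ ↦ h φ m
          map_add' := fun φ ψ ↦ by
            rw [show h (φ + ψ) = h φ + h ψ from map_add h (φ : OpDual k N) ψ]; rfl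
          map_smul' := fun c φ ↦ by
            rw [show h (c • φ) = c • h φ from hsmul c φ]; rfl }
      obtain ⟨n, hn⟩ := (Module.evalEquiv k N).surjective ev
      exact ⟨n, fun φ ↦ LinearMap.congr_fun hn φ⟩
    choose f hf using key
    refine ⟨{ toFun := f, map_add' := fun m m' ↦ ?_, map_smul' := fun b m ↦ ?_ }, ?_⟩
    · exact eq_of_forall_apply (k := k) fun φ ↦ by rw [hf, map_add, map_add, hf, hf]
    · refine eq_of_forall_apply (k := k) fun φ ↦ ?_
      rw [hf, RingHom.id_apply, ← op_unop b, ← smul_apply, ← map_smul, ← smul_apply, hf]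
    · ext φ m
      exact hf m φ

variable {L : Type*} [AddCommGroup L] [Module k L] [Module Aᵐᵒᵖ L] [IsScalarTower k Aᵐᵒᵖ L]

lemma map_injective {f : M →ₗ[Aᵐᵒᵖ] N} (hf : Function.Surjective f) :
    Function.Injective (map f : OpDual k N →ₗ[A] OpDual k M) := by
  intro φ ψ h
  ext n
  obtain ⟨m, rfl⟩ := hf n
  exact congrFun (congrArg DFunLike.coe h) m

lemma map_surjective {f : M →ₗ[Aᵐᵒᵖ] N} (hf : Function.Injective f) :
    Function.Surjective (map f : OpDual k N →ₗ[A] OpDual k M) := by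
  intro φ
  let f' : M →ₗ[k] N := { f with map_smul' := map_aux f }
  obtain ⟨l, hl⟩ := f'.exists_leftInverse_of_injective (LinearMap.ker_eq_bot.2 hf)
  refine ⟨mk (LinearMap.comp φ l), ?_⟩
  ext m
  exact congrArg φ (LinearMap.congr_fun hl m)

lemma map_exact {f : L →ₗ[Aᵐᵒᵖ] M} {g : M →ₗ[Aᵐᵒᵖ] N} (h : Function.Exact f g)
    (hg : Function.Surjective g) :
    Function.Exact (map g : OpDual k N →ₗ[A] OpDual k M) (map f) := by
  intro φ
  constructor
  · intro hφ
    replace hφ (x : L) : φ (f x) = 0 := congrFun (congrArg DFunLike.coe hφ) x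
    let g' : M →ₗ[k] N := { g with map_smul' := map_aux g }
    obtain ⟨r, hr⟩ := g'.exists_rightInverse_of_surjective (LinearMap.range_eq_top.2 hg)
    replace hr (x) : g (r x) = x := LinearMap.congr_fun hr x
    refine ⟨mk (LinearMap.comp φ r), ?_⟩
    ext m
    obtain ⟨x, hx⟩ := (h (r (g m) - m)).1 (by rw [map_sub, hr, sub_self])
    rw [← sub_eq_zero]
    change φ (r (g m)) - φ m = 0
    rw [← map_sub, ← hx, hφ]
  · rintro ⟨ψ, rfl⟩
    ext x
    rw [map_apply, map_apply, h.apply_apply_eq_zero, map_zero, zero_apply]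

/-- The dual of a projective right module is an injective left module. -/
lemma injective_of_projective {k A M : Type u} [Field k] [Ring A] [Algebra k A] [AddCommGroup M]
    [Module k M] [Module Aᵐᵒᵖ M] [IsScalarTower k Aᵐᵒᵖ M] [Module.Projective Aᵐᵒᵖ M] :
    Module.Injective A (OpDual k M) where
  out X Y _ _ _ _ f hf g := by
    obtain ⟨s, hs⟩ := Module.projective_def.1 ‹Module.Projective Aᵐᵒᵖ M›
    let _ : Module k X := Module.restrictScalars k A X
    let _ : Module k Y := Module.restrictScalars k A Y
    have : IsScalarTower k A X := IsScalarTower.restrictScalars k A X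
    have : IsScalarTower k A Y := IsScalarTower.restrictScalars k A Y
    obtain ⟨l, hl⟩ := (f.restrictScalars k).exists_leftInverse_of_injective
      (LinearMap.ker_eq_bot.2 hf)
    replace hl (x : X) : l (f x) = x := LinearMap.congr_fun hl x
    let E (y : Y) (q : M) : Aᵐᵒᵖ →ₗ[k] k :=
      { toFun := fun b ↦ g (l (unop b • y)) q
        map_add' := fun b c ↦ by simp [add_smul]
        map_smul' := fun c b ↦ by
          rw [unop_smul, smul_assoc, map_smul, LinearMap.map_smul_of_tower]; rfl }
    let F (y : Y) : (M →₀ Aᵐᵒᵖ) →ₗ[k] k := Finsupp.lsum k (E y)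
    have hF (y : Y) (v : M →₀ Aᵐᵒᵖ) : F y v = v.sum fun q b ↦ g (l (unop b • y)) q := rfl
    refine ⟨
      { toFun := fun y ↦ mk (F y ∘ₗ s.restrictScalars k)
        map_add' := fun y z ↦ ?_
        map_smul' := fun a y ↦ ?_ }, fun x ↦ ?_⟩
    · ext m
      simp [hF]
    · ext m
      change F (a • y) (s m) = F y (s (op a • m))
      rw [map_smul, hF, hF, Finsupp.sum_smul_index' (by simp)]
      simp [mul_smul]
    · ext m
      change F (f x) (s m) = g x m
      rw [hF]
      conv_rhs => rw [← hs m, Finsupp.linearCombination_apply, Finsupp.sum, map_sum]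
      rw [Finsupp.sum]
      refine Finset.sum_congr rfl fun q _ ↦ ?_
      rw [← map_smul, hl, map_smul, smul_apply, op_unop, id]

end OpDual

section Functor

open CategoryTheory
open scoped ModuleCat

variable {k A : Type u} [Field k] [Ring A] [Algebra k A]

variable (k A) in
/-- The duality functor from right modules to left modules. -/
@[simps]
noncomputable def opDualFunctor : (ModuleCat.{u} Aᵐᵒᵖ)ᵒᵖ ⥤ ModuleCat.{u} A where
  obj M := ModuleCat.of A (OpDual k M.unop)
  map f := ModuleCat.ofHom (OpDual.map f.unop.hom)

instance : (opDualFunctor k A).Additive where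
  map_add {X Y f g} := by
    ext φ
    exact OpDual.ext fun m ↦ map_add (show OpDual k X.unop from φ) _ _

lemma opDualFunctor_shortExact (S : ShortComplex (ModuleCat.{u} Aᵐᵒᵖ)) (hS : S.ShortExact) :
    (S.op.map (opDualFunctor k A)).ShortExact :=
  ModuleCat.shortComplex_shortExact _
    (OpDual.map_exact ((ShortComplex.ShortExact.moduleCat_exact_iff_function_exact _).1 hS.exact)
      hS.moduleCat_surjective_g)
    (OpDual.map_injective hS.moduleCat_surjective_g)
    (OpDual.map_surjective hS.moduleCat_injective_f)

lemma opDualFunctor_injective (P : ModuleCat.{u} Aᵐᵒᵖ) (hP : Projective P) :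
    Injective ((opDualFunctor k A).obj (.op P)) := by
  have : Module.Projective Aᵐᵒᵖ P := (IsProjective.iff_projective P).2 hP
  have := OpDual.injective_of_projective (k := k) (A := A) (M := P)
  exact Module.injective_object_of_injective_module A (OpDual k P)

lemma opDualFunctor_map_bijective (K X : ModuleCat.{u} Aᵐᵒᵖ) (hX : Module.Finite k X) :
    Function.Bijective (fun f : K ⟶ X ↦ (opDualFunctor k A).map f.op) :=
  (ModuleCat.homEquiv (M := ModuleCat.of A (OpDual k X)) (N := ModuleCat.of A (OpDual k K))
    ).symm.bijective.comp <|
    (OpDual.map_bijective (k := k) (A := A) (M := K) (N := X)).comp ModuleCat.homEquiv.bijective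

end Functor

end OpDual

section Transfer

universe w u

open CategoryTheory Abelian.Ext MulOpposite
open scoped ModuleCat

/-- An injective artinian module whose elements are separated by maps to `N` is a summand of a
finite power of `N`. -/
lemma idFactors_of_separating {R : Type u} [Ring R] {M N : Type u} [AddCommGroup M] [Module R M]
    [AddCommGroup N] [Module R N] [Module.Injective R M] [IsArtinian R M]
    (h : ∀ x : M, x ≠ 0 → ∃ f : M →ₗ[R] N, f x ≠ 0) :
    IdFactors (ModuleCat.of R M) (ModuleCat.of R N) := by
  classical
  obtain ⟨s, hs⟩ := Finset.exists_inf_le (fun f : M →ₗ[R] N ↦ LinearMap.ker f)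
  let e := s.equivFin.symm
  let φ : M →ₗ[R] (Fin s.card → N) := LinearMap.pi fun i ↦ (e i).1
  have hφ : Function.Injective φ := by
    rw [← LinearMap.ker_eq_bot, Submodule.eq_bot_iff]
    intro x hx
    by_contra hx0
    obtain ⟨f, hf⟩ := h x hx0
    refine hf (hs f ?_)
    rw [Submodule.mem_finsetInf]
    intro g hg
    have := congrFun hx (e.symm ⟨g, hg⟩)
    simpa [φ] using this
  obtain ⟨r, hr⟩ := Module.Injective.out φ hφ LinearMap.id
  refine ⟨s.card, fun i ↦ ModuleCat.ofHom (e i).1,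
    fun i ↦ ModuleCat.ofHom (r ∘ₗ LinearMap.single R (fun _ ↦ N) i), ?_⟩
  ext x
  simp only [ModuleCat.hom_sum, ModuleCat.hom_comp, ModuleCat.hom_ofHom, LinearMap.sum_apply]
  change ∑ i, r (Pi.single i ((e i).1 x)) = x
  rw [← map_sum]
  refine Eq.trans (congrArg r ?_) (hr x)
  exact Finset.univ_sum_single (φ x)

lemma Module.projective_mulOpposite_self (R : Type*) [Ring R] : Module.Projective Rᵐᵒᵖ R :=
  .of_equiv
    { opAddEquiv.symm with
      map_smul' := fun _ _ ↦ rfl : Rᵐᵒᵖ ≃ₗ[Rᵐᵒᵖ] R }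

section

variable (k R : Type u) [Field k] [Ring R] [Algebra k R] [Module.Finite k R] [Module.Injective R R]

include k in
lemma idFactors_self_opDual :
    IdFactors (ModuleCat.of R R) (ModuleCat.of R (OpDual k R)) := by
  have : IsArtinianRing R := IsArtinianRing.of_finite k R
  refine idFactors_of_separating fun x hx ↦ ?_
  obtain ⟨φ, hφ⟩ := not_forall.1 (mt (Module.forall_dual_apply_eq_zero_iff k x).1 hx)
  exact ⟨LinearMap.toSpanSingleton R (OpDual k R) (.mk φ), fun h0 ↦ hφ <| by
    simpa using congrFun (congrArg DFunLike.coe h0) 1⟩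

lemma idFactors_opDual_self :
    IdFactors (ModuleCat.of R (OpDual k R)) (ModuleCat.of R R) := by
  have : IsArtinian R (OpDual k R) := isArtinian_of_tower k inferInstance
  have := Module.projective_mulOpposite_self R
  have := OpDual.injective_of_projective (k := k) (A := R) (M := R)
  exact idFactors_of_separating fun x hx ↦ Module.Injective.exists_apply_ne_zero k hx

end

lemma CategoryTheory.Abelian.Ext.isGeneratedInDegreeOne_congr {C : Type*} [Category* C] [Abelian C]
    [HasExt.{w} C] {X Y : C} (e : X ≅ Y) : IsGeneratedInDegreeOne X ↔ IsGeneratedInDegreeOne Y :=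
  ⟨fun h ↦ h.of_idFactors (.of_iso e) (.of_iso e.symm),
    fun h ↦ h.of_idFactors (.of_iso e.symm) (.of_iso e)⟩

variable {k A R : Type u} [Field k] [Ring A] [Algebra k A] [Ring R] [Algebra k R]

/-- Duality commutes with restriction of scalars. -/
noncomputable def opDualRestrictScalarsEquiv (ε : A →+* R)
    (hε : ∀ c, ε (algebraMap k A c) = algebraMap k R c) :
    OpDual k ((ModuleCat.restrictScalars (RingHom.op ε)).obj (ModuleCat.of Rᵐᵒᵖ R)) ≃ₗ[A]
      (ModuleCat.restrictScalars ε).obj (ModuleCat.of R (OpDual k R)) :=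
  have h (c : k) (r : R) : (c • (show (ModuleCat.restrictScalars (RingHom.op ε)).obj
      (ModuleCat.of Rᵐᵒᵖ R) from r)) = c • r := by
    change r * ε (algebraMap k A c) = _
    rw [hε, ← Algebra.commutes, Algebra.smul_def]
  { toFun := fun φ ↦ OpDual.mk
      { toFun := fun r ↦ φ r
        map_add' := fun r s ↦ map_add φ r s
        map_smul' := fun c r ↦ (congrArg φ (h c r).symm).trans (map_smul φ c
          (id r : (ModuleCat.restrictScalars (RingHom.op ε)).obj (ModuleCat.of Rᵐᵒᵖ R))) }
    invFun := fun φ ↦ OpDual.mk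
      { toFun := fun r ↦ (show OpDual k R from φ) r
        map_add' := fun r s ↦ map_add (show OpDual k R from φ) r s
        map_smul' := fun c r ↦ (congrArg (show OpDual k R from φ) (h c r)).trans
          (map_smul (show OpDual k R from φ) c (id r : R)) }
    left_inv := fun _ ↦ rfl
    right_inv := fun _ ↦ rfl
    map_add' := fun _ _ ↦ rfl
    map_smul' := fun _ _ ↦ rfl }

/-- The isomorphism of modules underlying `opDualRestrictScalarsEquiv`. -/
noncomputable def opDualRestrictScalarsIso (ε : A →+* R)
    (hε : ∀ c, ε (algebraMap k A c) = algebraMap k R c) :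
    (opDualFunctor k A).obj
        (.op ((ModuleCat.restrictScalars (RingHom.op ε)).obj (ModuleCat.of Rᵐᵒᵖ R))) ≅
      (ModuleCat.restrictScalars ε).obj (ModuleCat.of R (OpDual k R)) :=
  (opDualRestrictScalarsEquiv ε hε).toModuleIso

theorem isGeneratedInDegreeOne_restrictScalars_iff [Module.Finite k R] [Module.Injective R R]
    [HasExt.{w} (ModuleCat.{u} A)] [HasExt.{w} (ModuleCat.{u} Aᵐᵒᵖ)] (ε : A →+* R)
    (hε : ∀ c, ε (algebraMap k A c) = algebraMap k R c) :
    IsGeneratedInDegreeOne ((ModuleCat.restrictScalars ε).obj (ModuleCat.of R R)) ↔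
      IsGeneratedInDegreeOne
        ((ModuleCat.restrictScalars (RingHom.op ε)).obj (ModuleCat.of Rᵐᵒᵖ R)) := by
  have hfin : Module.Finite k
      ((ModuleCat.restrictScalars (RingHom.op ε)).obj (ModuleCat.of Rᵐᵒᵖ R)) := by
    refine Module.Finite.of_surjective (M := R) (σ := RingHom.id k)
      { toFun := fun r ↦ r, map_add' := fun _ _ ↦ rfl, map_smul' := fun c r ↦ ?_ }
      fun r ↦ ⟨r, rfl⟩
    change c • r = r * ε (algebraMap k A c)
    rw [hε, ← Algebra.commutes, Algebra.smul_def]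
  rw [isGeneratedInDegreeOne_op_map_iff (opDualFunctor k A) opDualFunctor_shortExact
    opDualFunctor_injective _ (fun K ↦ opDualFunctor_map_bijective K _ hfin),
    isGeneratedInDegreeOne_congr (opDualRestrictScalarsIso ε hε)]
  have h₁ := (idFactors_self_opDual k R).map (ModuleCat.restrictScalars ε)
  have h₂ := (idFactors_opDual_self k R).map (ModuleCat.restrictScalars ε)
  exact ⟨fun h ↦ h.of_idFactors h₁ h₂, fun h ↦ h.of_idFactors h₂ h₁⟩

end Transfer

section Graded

open CategoryTheory Abelian.Ext MulOpposite

variable {k A : Type} [Field k] [Ring A] [Algebra k A] (𝒜 : ℕ → Submodule k A) [GradedAlgebra 𝒜]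

lemma projZeroRingHom'_eq_zero {i : ℕ} {a : A} (ha : a ∈ 𝒜 (i + 1)) :
    GradedRing.projZeroRingHom' 𝒜 a = 0 :=
  Subtype.ext (DirectSum.decompose_of_mem_ne 𝒜 ha i.succ_ne_zero)

lemma projZeroRingHom'_algebraMap (c : k) :
    GradedRing.projZeroRingHom' 𝒜 (algebraMap k A c) = algebraMap k (𝒜 0) c :=
  GradedRing.projZeroRingHom'_apply_coe 𝒜 (algebraMap k (𝒜 0) c)

lemma mem_of_projZeroRingHom'_eq_zero {S : Type*} [SetLike S A] [AddSubmonoidClass S A] (J : S)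
    (hJ : ∀ i, ∀ a ∈ 𝒜 (i + 1), a ∈ J) {a : A} (ha : GradedRing.projZeroRingHom' 𝒜 a = 0) :
    a ∈ J := by
  classical
  rw [← DirectSum.sum_support_decompose 𝒜 a]
  refine sum_mem fun i _ ↦ ?_
  cases i with
  | zero =>
    have h0 : (DirectSum.decompose 𝒜 a 0 : A) = 0 := congrArg Subtype.val ha
    rw [h0]
    exact zero_mem J
  | succ i => exact hJ i _ (SetLike.coe_mem _)

lemma ker_projZeroRingHom'_eq :
    RingHom.ker (GradedRing.projZeroRingHom' 𝒜) = GenK.Jideal k A 𝒜 := by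
  refine le_antisymm (fun a ha ↦ mem_of_projZeroRingHom'_eq_zero 𝒜 _
    (fun i a ha ↦ Submodule.subset_span (Set.mem_iUnion.2 ⟨i, ha⟩)) ha) (Submodule.span_le.2 ?_)
  intro a ha
  obtain ⟨i, hi⟩ := Set.mem_iUnion.1 ha
  exact projZeroRingHom'_eq_zero 𝒜 hi

lemma ker_op_projZeroRingHom'_eq :
    RingHom.ker (RingHom.op (GradedRing.projZeroRingHom' 𝒜)) = GenK.Jideal k Aᵐᵒᵖ
      (fun i => (𝒜 i).map (MulOpposite.opLinearEquiv k : A ≃ₗ[k] Aᵐᵒᵖ).toLinearMap) := by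
  set J := GenK.Jideal k Aᵐᵒᵖ
    (fun i => (𝒜 i).map (MulOpposite.opLinearEquiv k : A ≃ₗ[k] Aᵐᵒᵖ).toLinearMap) with hJ
  refine le_antisymm (fun a ha ↦ ?_) (Submodule.span_le.2 ?_)
  · have hmem : ∀ i, ∀ a ∈ 𝒜 (i + 1), op a ∈ J := fun i a ha ↦
      Submodule.subset_span (Set.mem_iUnion.2 ⟨i, Submodule.mem_map_of_mem ha⟩)
    have ha' : GradedRing.projZeroRingHom' 𝒜 a.unop = 0 := congrArg unop ha
    clear_value J
    exact mem_of_projZeroRingHom'_eq_zero 𝒜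
      (J.toAddSubgroup.comap (opAddEquiv : A ≃+ Aᵐᵒᵖ).toAddMonoidHom) hmem ha'
  · intro a ha
    obtain ⟨i, b, hb, rfl⟩ := Set.mem_iUnion.1 ha
    exact congrArg op (projZeroRingHom'_eq_zero 𝒜 hb)

end Graded

section

universe u

open CategoryTheory MulOpposite

/-- The quotient by the kernel of a surjective ring homomorphism is the target. -/
noncomputable def quotientIsoRestrictScalars {A R : Type u} [Ring A] [Ring R] (ε : A →+* R)
    (hε : Function.Surjective ε) (J : Ideal A) (hJ : RingHom.ker ε = J) :
    ModuleCat.of A (A ⧸ J) ≅ (ModuleCat.restrictScalars ε).obj (ModuleCat.of R R) :=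
  let f : A →ₗ[A] (ModuleCat.restrictScalars ε).obj (ModuleCat.of R R) :=
    { toFun := fun a ↦ ε a, map_add' := map_add ε, map_smul' := map_mul ε }
  LinearEquiv.toModuleIso (Submodule.quotEquivOfEq J (LinearMap.ker f) hJ.symm ≪≫ₗ
    f.quotKerEquivOfSurjective hε)

/-- A ring is isomorphic to its opposite as a right module. -/
def opSelfIso (R : Type u) [Ring R] : ModuleCat.of Rᵐᵒᵖ Rᵐᵒᵖ ≅ ModuleCat.of Rᵐᵒᵖ R :=
  LinearEquiv.toModuleIso { opAddEquiv.symm with map_smul' := fun _ _ ↦ rfl }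

end

open GenK CategoryTheory in
/-- the graded algebra `A` is quasi-Koszul if and only if the opposite
algebra `A^op` (with the induced grading `𝒜^op i = op(𝒜 i)`) is quasi-Koszul. -/
theorem stmt14 (k A : Type) [Field k] [Ring A] [Algebra k A] (𝒜 : ℕ → Submodule k A)
    [GradedAlgebra 𝒜] [HasExt.{0} (ModuleCat.{0} A)]
    [HasExt.{0} (ModuleCat.{0} Aᵐᵒᵖ)]
    (hloc : ∀ i, FiniteDimensional k (𝒜 i))
    (hgen01 : ∀ i j, 𝒜 i * 𝒜 j = 𝒜 (i + j))
    (hsi : SelfInjectiveDegZero k A 𝒜) :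
    QuasiKoszulAlg k A 𝒜 ↔
      QuasiKoszulAlg k Aᵐᵒᵖ
        (fun i => (𝒜 i).map (MulOpposite.opLinearEquiv k : A ≃ₗ[k] Aᵐᵒᵖ).toLinearMap) := by
  have : Module.Finite k (𝒜 0) := hloc 0
  have : Module.Injective (𝒜 0) (𝒜 0) := hsi (𝒜 0) inferInstance
  have hε := GradedRing.projZeroRingHom'_surjective 𝒜
  have hε' : Function.Surjective (RingHom.op (GradedRing.projZeroRingHom' 𝒜)) :=
    fun r ↦ (hε r.unop).imp' MulOpposite.op fun _ h ↦ congrArg MulOpposite.op h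
  refine Iff.trans (Abelian.Ext.isGeneratedInDegreeOne_congr
    (quotientIsoRestrictScalars _ hε _ (ker_projZeroRingHom'_eq 𝒜))) ?_
  refine (isGeneratedInDegreeOne_restrictScalars_iff (k := k) (GradedRing.projZeroRingHom' 𝒜)
    (projZeroRingHom'_algebraMap 𝒜)).trans ?_
  exact (Abelian.Ext.isGeneratedInDegreeOne_congr
    (quotientIsoRestrictScalars _ hε' _ (ker_op_projZeroRingHom'_eq 𝒜) ≪≫
      (ModuleCat.restrictScalars _).mapIso (opSelfIso (𝒜 0)))).symm
end

section
/- Let C be a directed k-linear category with respect to a partial order ≤ on its objects. Then C is standardly stratified (for the canonical pre-order induced by ≤) if and only if the morphism space C(x,y) is a projective C(y,y)-module for every pair of objects x, y. -/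
namespace Stmt16

variable {A : Type} [Ring A]

/-- The "hom-space" `C(x,y) = v·A·u` attached to idempotents `u, v` of `A`:
elements `a` with `v * a = a` and `a * u = a`. -/
def HomSp (u v : A) : Type := {a : A // v * a = a ∧ a * u = a}

instance (u v : A) : Zero (HomSp u v) := ⟨⟨0, by simp, by simp⟩⟩
instance (u v : A) : Add (HomSp u v) :=
  ⟨fun a b => ⟨a.1 + b.1, by rw [mul_add, a.2.1, b.2.1], by rw [add_mul, a.2.2, b.2.2]⟩⟩
instance (u v : A) : Neg (HomSp u v) :=
  ⟨fun a => ⟨-a.1, by rw [mul_neg, a.2.1], by rw [neg_mul, a.2.2]⟩⟩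

instance (u v : A) : AddCommGroup (HomSp u v) where
  add_assoc a b c := Subtype.ext (add_assoc a.1 b.1 c.1)
  zero_add a := Subtype.ext (zero_add a.1)
  add_zero a := Subtype.ext (add_zero a.1)
  neg_add_cancel a := Subtype.ext (neg_add_cancel a.1)
  add_comm a b := Subtype.ext (add_comm a.1 b.1)
  nsmul := nsmulRec
  zsmul := zsmulRec

/-- The corner ring `C(y,y) = v·A·v` attached to an idempotent `v` of `A`. -/
def cornerRing (v : A) (hv : v * v = v) : Ring (HomSp v v) :=
  { (inferInstance : AddCommGroup (HomSp v v)) with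
    mul := fun a b => ⟨a.1 * b.1,
      by rw [← mul_assoc, a.2.1], by rw [mul_assoc, b.2.2]⟩
    one := ⟨v, hv, hv⟩
    mul_assoc := fun a b c => Subtype.ext (mul_assoc a.1 b.1 c.1)
    one_mul := fun a => Subtype.ext a.2.1
    mul_one := fun a => Subtype.ext a.2.2
    left_distrib := fun a b c => by
      apply Subtype.ext
      show a.1 * (b.1 + c.1) = a.1 * b.1 + a.1 * c.1
      exact mul_add _ _ _
    right_distrib := fun a b c => by
      apply Subtype.ext
      show (a.1 + b.1) * c.1 = a.1 * c.1 + b.1 * c.1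
      exact add_mul _ _ _
    zero_mul := fun a => by
      apply Subtype.ext
      show (0 : A) * a.1 = 0
      exact zero_mul _
    mul_zero := fun a => by
      apply Subtype.ext
      show a.1 * (0 : A) = 0
      exact mul_zero _ }

/-- `C(x,y)` as a left module over the corner ring `C(y,y)`, by composition
(left multiplication). -/
def homModule (u v : A) (hv : v * v = v) :
    letI := cornerRing v hv
    Module (HomSp v v) (HomSp u v) :=
  letI := cornerRing v hv
  { smul := fun r a => ⟨r.1 * a.1, by rw [← mul_assoc, r.2.1], by rw [mul_assoc, a.2.2]⟩
    one_smul := fun a => Subtype.ext a.2.1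
    mul_smul := fun r s a => Subtype.ext (mul_assoc r.1 s.1 a.1)
    smul_zero := fun r => by
      apply Subtype.ext
      show r.1 * (0 : A) = 0
      exact mul_zero _
    smul_add := fun r a b => by
      apply Subtype.ext
      show r.1 * (a.1 + b.1) = r.1 * a.1 + r.1 * b.1
      exact mul_add _ _ _
    add_smul := fun r s a => by
      apply Subtype.ext
      show (r.1 + s.1) * a.1 = r.1 * a.1 + s.1 * a.1
      exact add_mul _ _ _
    zero_smul := fun a => by
      apply Subtype.ext
      show (0 : A) * a.1 = 0
      exact zero_mul _ }

/-- The morphism space `C(x,y)` is a projective module over the endomorphism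
ring `C(y,y)`. -/
def HomSpIsProjective (u v : A) (hv : v * v = v) : Prop :=
  letI := cornerRing v hv
  letI := homModule u v hv
  Module.Projective (HomSp v v) (HomSp u v)

/-- `a` is a primitive idempotent of the ring `A`. -/
def IsPrimitiveIdem (a : A) : Prop :=
  a ≠ 0 ∧ a * a = a ∧
    ∀ b c : A, b * b = b → c * c = c → b * c = 0 → c * b = 0 → b + c = a →
      b = 0 ∨ c = 0

variable (A)
variable {X : Type} (Λ : X → Type) (f : ∀ x, Λ x → A)

/-- The indecomposable projective `P_λ = A·e_λ`. -/
def P (lam : Σ x, Λ x) : Submodule A A := Submodule.span A {f lam.1 lam.2}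

/-- The trace of `P_μ` in `P_λ`: the sum of the images of all module homomorphisms
`P_μ → P_λ`. -/
def trace (mu lam : Σ x, Λ x) : Submodule A ↥(P A Λ f lam) :=
  ⨆ g : ↥(P A Λ f mu) →ₗ[A] ↥(P A Λ f lam), LinearMap.range g

variable [PartialOrder X]

/-- The standard module
`Δ_λ = P_λ / Σ_{μ ⋠ λ} tr_{P_μ}(P_λ)`, with respect to the canonical pre-order
`μ ⪯ λ ↔ x_μ ≤ x_λ` on primitive idempotents. -/
def Delta (lam : Σ x, Λ x) : Type :=
  ↥(P A Λ f lam) ⧸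
    (⨆ mu : Σ x, Λ x, ⨆ _ : ¬ mu.1 ≤ lam.1, trace A Λ f mu lam)

noncomputable instance (lam : Σ x, Λ x) : AddCommGroup (Delta A Λ f lam) :=
  inferInstanceAs (AddCommGroup (_ ⧸ _))

noncomputable instance (lam : Σ x, Λ x) : Module A (Delta A Λ f lam) :=
  inferInstanceAs (Module A (_ ⧸ _))

/-- `V` has a filtration by standard modules. -/
def HasDeltaFiltration (V : Type) [AddCommGroup V] [Module A V] : Prop :=
  ∃ (n : ℕ) (F : Fin (n + 1) → Submodule A V), Monotone F ∧
    F 0 = ⊥ ∧ F (Fin.last n) = ⊤ ∧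
    ∀ i : Fin n, ∃ mu : Σ x, Λ x,
      Nonempty
        ((↥(F i.succ) ⧸ Submodule.comap (F i.succ).subtype (F i.castSucc))
          ≃ₗ[A] Delta A Λ f mu)

/-- The directed category `C` is standardly stratified (for the canonical pre-order):
every indecomposable projective module has a filtration by standard modules. -/
def StandardlyStratified : Prop :=
  ∀ lam : Σ x, Λ x, HasDeltaFiltration A Λ f ↥(P A Λ f lam)

end Stmt16

namespace Stmt16

open Polynomial in
/-- An element of the corner ring of a primitive idempotent of a finite-dimensional algebra
is nilpotent or right invertible in that corner. -/
theorem IsPrimitiveIdem.isNilpotent_or_exists_mul_eq {k A : Type} [Field k] [Ring A] [Algebra k A]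
    [FiniteDimensional k A] {a : A} (ha : IsPrimitiveIdem a) {c : A} (hl : a * c = c)
    (hr : c * a = c) : IsNilpotent c ∨ ∃ d, c * d = a := by
  obtain ⟨-, hidem, hdecomp⟩ := ha
  have hp : minpoly k c ≠ 0 := minpoly.ne_zero (Algebra.IsIntegral.isIntegral c)
  obtain ⟨q, hq, hdvd⟩ := Polynomial.exists_eq_pow_rootMultiplicity_mul_and_not_dvd _ hp 0
  set n := (minpoly k c).rootMultiplicity 0
  rw [map_zero, sub_zero] at hq hdvd
  have hcop : IsCoprime (X ^ (n + 1)) q :=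
    ((Polynomial.irreducible_X.coprime_iff_not_dvd).2 hdvd).pow_left
  obtain ⟨r, s, hrs⟩ := hcop
  have hzero : aeval c (X ^ (n + 1) * q) = 0 := by
    rw [pow_succ', mul_assoc, ← hq, map_mul, minpoly.aeval, mul_zero]
  set E := aeval c (X ^ (n + 1) * r) with hE
  have hEc : E = c * (c ^ n * aeval c r) := by
    simp [hE, pow_succ', mul_assoc]
  have hEc' : E = (aeval c r * c ^ n) * c := by
    rw [hE, mul_comm, map_mul, map_pow, aeval_X, pow_succ, mul_assoc]
  have hEidem : E * E = E := by
    have h : X ^ (n + 1) * r * (X ^ (n + 1) * r) =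
        X ^ (n + 1) * r - r * s * (X ^ (n + 1) * q) := by
      linear_combination (X ^ (n + 1) * r) * hrs
    rw [hE, ← map_mul, h, map_sub, map_mul _ (r * s), hzero, mul_zero, sub_zero]
  have haE : a * E = E := by rw [hEc, ← mul_assoc, hl]
  have hEa : E * a = E := by rw [hEc', mul_assoc, hr]
  rcases hdecomp E (a - E) hEidem (by simp [mul_sub, sub_mul, hidem, haE, hEa, hEidem])
    (by simp [mul_sub, hEa, hEidem]) (by simp [sub_mul, haE, hEidem])
    (add_sub_cancel _ _) with h | h
  · left
    refine ⟨n + 1, ?_⟩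
    have h' : X ^ (n + 1) = X ^ (n + 1) * (X ^ (n + 1) * r) + s * (X ^ (n + 1) * q) := by
      linear_combination -(X ^ (n + 1)) * hrs
    have := congrArg (aeval c) h'
    rwa [map_add, map_mul, map_mul _ s, hzero, ← hE, h, mul_zero, mul_zero, add_zero, map_pow,
      aeval_X] at this
  · right
    exact ⟨_, hEc.symm.trans (sub_eq_zero.1 h).symm⟩

theorem projective_of_surjective_of_endomorphism {R M Q : Type*} [Ring R] [AddCommGroup M]
    [Module R M] [AddCommGroup Q] [Module R Q] [Module.Projective R M] (p : M →ₗ[R] Q)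
    (hp : Function.Surjective p) (t : M →ₗ[R] M) (hker : ∀ m, p m = 0 → t m = 0)
    (ht : ∀ m, p (t m) = p m) : Module.Projective R Q := by
  refine Module.Projective.of_split
    ((LinearMap.ker p).liftQ t hker ∘ₗ (p.quotKerEquivOfSurjective hp).symm.toLinearMap) p ?_
  ext q
  obtain ⟨m, rfl⟩ := hp q
  have : (p.quotKerEquivOfSurjective hp).symm (p m) = Submodule.Quotient.mk m := by
    rw [LinearEquiv.symm_apply_eq]; rfl
  rw [LinearMap.comp_apply, LinearMap.comp_apply, LinearEquiv.coe_coe, this]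
  exact ht m

theorem projective_of_exact {R L M Q : Type*} [Ring R] [AddCommGroup L] [Module R L]
    [AddCommGroup M] [Module R M] [AddCommGroup Q] [Module R Q] [Module.Projective R L]
    [Module.Projective R Q] (j : L →ₗ[R] M) (p : M →ₗ[R] Q) (hj : Function.Injective j)
    (hp : Function.Surjective p) (hexact : Function.Exact j p) : Module.Projective R M := by
  obtain ⟨s, hs⟩ := p.exists_rightInverse_of_surjective (LinearMap.range_eq_top.2 hp)
  have hps (q : Q) : p (s q) = q := LinearMap.congr_fun hs q
  refine Module.Projective.of_equiv' (LinearEquiv.ofBijective (j.coprod s) ⟨?_, fun m => ?_⟩)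
  · refine (injective_iff_map_eq_zero _).2 fun ⟨l, q⟩ h => ?_
    simp only [LinearMap.coprod_apply] at h
    have hq : q = 0 := by
      simpa [hps, hexact.apply_apply_eq_zero] using congrArg p h
    subst hq
    rw [map_zero, add_zero] at h
    simp [(map_eq_zero_iff j hj).1 h]
  · obtain ⟨l, hl⟩ := (hexact (m - s (p m))).1 (by rw [map_sub, hps, sub_self])
    exact ⟨(l, p m), by rw [LinearMap.coprod_apply, hl, sub_add_cancel]⟩

/-- A nonzero projective module over a ring whose unit is a sum of idempotents with local corners
splits off one of the corresponding cyclic projectives. -/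
theorem exists_apply_eq_idempotent {B Q ι : Type*} [Ring B] [AddCommGroup Q] [Module B Q]
    [Module.Projective B Q] [Nontrivial Q] [IsCoatomic (Submodule B Q)] [Fintype ι] (F : ι → B)
    (hidem : ∀ i, F i * F i = F i) (hsum : ∑ i, F i = 1)
    (hlocal : ∀ i c, F i * c = c → c * F i = c → IsNilpotent c ∨ ∃ d, c * d = F i) :
    ∃ (i : ι) (m : Q) (φ : Q →ₗ[B] B), m ≠ 0 ∧ φ m = F i ∧ F i • m = m := by
  obtain ⟨N, hN, -⟩ := (IsCoatomic.eq_top_or_exists_le_coatom (⊥ : Submodule B Q)).resolve_left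
    bot_ne_top
  have : IsSimpleModule B (Q ⧸ N) := isSimpleModule_iff_isCoatom.2 hN
  obtain ⟨q, hq⟩ : ∃ q, q ∉ N := by
    by_contra! h
    exact hN.1 (eq_top_iff.2 fun q _ => h q)
  obtain ⟨i, hi⟩ : ∃ i, F i • q ∉ N := by
    by_contra! h
    refine hq ?_
    rw [← one_smul B q, ← hsum, Finset.sum_smul]
    exact N.sum_mem fun i _ => h i
  have hs : N.mkQ (F i • q) ≠ 0 := by
    rwa [Submodule.mkQ_apply, Ne, Submodule.Quotient.mk_eq_zero]
  obtain ⟨h, hh⟩ := Module.projective_lifting_property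
    (LinearMap.toSpanSingleton B (Q ⧸ N) (N.mkQ (F i • q))) N.mkQ
    (IsSimpleModule.toSpanSingleton_surjective B hs)
  have hh' (n : Q) : h n • N.mkQ (F i • q) = N.mkQ n := LinearMap.congr_fun hh n
  set m := F i • q with hm
  have hFm : F i • m = m := by rw [hm, smul_smul, hidem]
  set c := h m * F i with hc
  have hFh : F i * h m = h m := by rw [← smul_eq_mul, ← map_smul, hFm]
  have hcm : c • N.mkQ m = N.mkQ m := by
    rw [hc, mul_smul, ← map_smul N.mkQ (F i), hFm, hh']
  rcases hlocal i c (by rw [hc, ← mul_assoc, hFh]) (by rw [hc, mul_assoc, hidem]) with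
    ⟨n, hn⟩ | ⟨d, hd⟩
  · refine absurd ?_ hs
    have hpow (n : ℕ) : c ^ n • N.mkQ m = N.mkQ m := by
      induction n with
      | zero => rw [pow_zero, one_smul]
      | succ n ih => rw [pow_succ, mul_smul, hcm, ih]
    rw [← hpow n, hn, zero_smul]
  · refine ⟨i, m, (LinearMap.toSpanSingleton B B (F i * d)) ∘ₗ h, ?_, ?_, hFm⟩
    · exact fun h0 => hs (by rw [h0, map_zero])
    · rw [LinearMap.comp_apply, LinearMap.toSpanSingleton_apply, smul_eq_mul, ← mul_assoc, ← hc, hd]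

theorem nonempty_range_equiv_of_ker_eq {R M N L : Type*} [Ring R] [AddCommGroup M] [Module R M]
    [AddCommGroup N] [Module R N] [AddCommGroup L] [Module R L] (g : M →ₗ[R] N) (t : M →ₗ[R] L)
    (ht : Function.Surjective t) (hker : LinearMap.ker g = LinearMap.ker t) :
    Nonempty (LinearMap.range g ≃ₗ[R] L) :=
  ⟨g.quotKerEquivRange.symm ≪≫ₗ Submodule.quotEquivOfEq _ _ hker ≪≫ₗ
    t.quotKerEquivOfSurjective ht⟩

section Peirce

variable {A : Type} [Ring A] {v : A} (hv : v * v = v)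

/-- The corner ring `v·A·v`, carrying the ring structure `cornerRing`. -/
def Corner (_ : v * v = v) : Type := HomSp v v

instance : Ring (Corner hv) := cornerRing v hv

instance (u : A) : Module (Corner hv) (HomSp u v) := homModule u v hv

namespace Corner

variable {hv}

/-- The element of `A` underlying an element of the corner ring. -/
def val (b : Corner hv) : A := Subtype.val b

/-- An element of the corner ring, from an element of `A` fixed by `v` on both sides. -/
def mk (a : A) (hl : v * a = a) (hr : a * v = a) : Corner hv := ⟨a, hl, hr⟩

@[ext] theorem ext {b c : Corner hv} (h : b.val = c.val) : b = c := Subtype.ext h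

@[simp] theorem val_mk (a : A) (hl : v * a = a) (hr : a * v = a) :
    (mk a hl hr : Corner hv).val = a := rfl
@[simp] theorem mul_val (b : Corner hv) : v * b.val = b.val := b.2.1
@[simp] theorem val_mul_right (b : Corner hv) : b.val * v = b.val := b.2.2
@[simp] theorem val_mul (b c : Corner hv) : (b * c).val = b.val * c.val := rfl
@[simp] theorem val_add (b c : Corner hv) : (b + c).val = b.val + c.val := rfl
@[simp] theorem val_zero : (0 : Corner hv).val = 0 := rfl
@[simp] theorem val_one : (1 : Corner hv).val = v := rfl

theorem val_sum {ι : Type*} (s : Finset ι) (b : ι → Corner hv) :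
    (∑ i ∈ s, b i).val = ∑ i ∈ s, (b i).val :=
  map_sum (⟨⟨val, val_zero⟩, val_add⟩ : Corner hv →+ A) b s

theorem val_pow_succ (b : Corner hv) (n : ℕ) : (b ^ (n + 1)).val = b.val ^ (n + 1) := by
  induction n with
  | zero => simp
  | succ n ih => rw [pow_succ, val_mul, ih, ← pow_succ]

end Corner

/-- The component `v·M` of a module `M` at an idempotent `v`. -/
def peirce (v : A) (M : Type*) [AddCommGroup M] [Module A M] : AddSubgroup M where
  carrier := {m | v • m = m}
  zero_mem' := smul_zero v
  add_mem' {m n} hm hn := (smul_add v m n).trans (congrArg₂ (· + ·) hm hn)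
  neg_mem' {m} hm := (smul_neg v m).trans (congrArg Neg.neg hm)

variable {M N L : Type*} [AddCommGroup M] [Module A M] [AddCommGroup N] [Module A N]
  [AddCommGroup L] [Module A L]

theorem mem_peirce {m : M} : m ∈ peirce v M ↔ v • m = m := Iff.rfl

theorem smul_mem_peirce (hv : v * v = v) (m : M) : v • m ∈ peirce v M := by
  rw [mem_peirce, smul_smul, hv]

instance : Module (Corner hv) (peirce v M) where
  smul b m := ⟨b.val • (m : M), by rw [mem_peirce, smul_smul, b.mul_val]⟩
  one_smul m := Subtype.ext m.2
  mul_smul b c m := Subtype.ext (mul_smul b.val c.val (m : M))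
  smul_zero b := Subtype.ext (smul_zero b.val)
  smul_add b m n := Subtype.ext (smul_add b.val (m : M) n)
  add_smul b c m := Subtype.ext (add_smul b.val c.val (m : M))
  zero_smul m := Subtype.ext (zero_smul A (m : M))

@[simp] theorem coe_corner_smul (b : Corner hv) (m : peirce v M) :
    ((b • m : peirce v M) : M) = b.val • (m : M) := rfl

/-- The map induced on components at an idempotent by a linear map. -/
def peirceMap (g : M →ₗ[A] N) : peirce v M →ₗ[Corner hv] peirce v N where
  toFun m := ⟨g m, by rw [mem_peirce, ← map_smul, mem_peirce.1 m.2]⟩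
  map_add' m n := Subtype.ext (map_add g (m : M) n)
  map_smul' b m := Subtype.ext (map_smul g b.val (m : M))

@[simp] theorem coe_peirceMap (g : M →ₗ[A] N) (m : peirce v M) :
    (peirceMap hv g m : N) = g m := rfl

theorem peirceMap_surjective {g : M →ₗ[A] N} (hg : Function.Surjective g) :
    Function.Surjective (peirceMap hv g) := fun n => by
  obtain ⟨m, hm⟩ := hg n
  exact ⟨⟨v • m, smul_mem_peirce hv m⟩, Subtype.ext (by simp [hm, mem_peirce.1 n.2])⟩

theorem projective_peirce_of_exact (j : L →ₗ[A] M) (g : M →ₗ[A] N) (hj : Function.Injective j)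
    (hg : Function.Surjective g) (hexact : Function.Exact j g)
    [Module.Projective (Corner hv) (peirce v L)] [Module.Projective (Corner hv) (peirce v N)] :
    Module.Projective (Corner hv) (peirce v M) := by
  refine projective_of_exact (peirceMap hv j) (peirceMap hv g)
    (fun l l' h => Subtype.ext (hj (congrArg Subtype.val h))) (peirceMap_surjective hv hg)
    fun m => ⟨fun h => ?_, ?_⟩
  · obtain ⟨l, hl⟩ := (hexact (m : M)).1 (congrArg Subtype.val h)
    exact ⟨⟨v • l, smul_mem_peirce hv l⟩, Subtype.ext (by simp [hl, mem_peirce.1 m.2])⟩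
  · rintro ⟨l, rfl⟩
    exact Subtype.ext (hexact.apply_apply_eq_zero l)

instance [IsNoetherian A M] : IsNoetherian (Corner hv) (peirce v M) := by
  rw [isNoetherian_iff']
  let S : Submodule (Corner hv) (peirce v M) → Submodule A M :=
    fun W => Submodule.span A (Subtype.val '' (W : Set (peirce v M)))
  have hS (W : Submodule (Corner hv) (peirce v M)) {m : M} (hm : m ∈ S W) (a : A) :
      ⟨v • a • m, smul_mem_peirce hv (a • m)⟩ ∈ W := by
    induction hm using Submodule.span_induction generalizing a with
    | mem m hm =>
      obtain ⟨w, hw, rfl⟩ := hm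
      convert W.smul_mem (Corner.mk (v * a * v) (by simp [← mul_assoc, hv])
        (by simp [mul_assoc, hv]) : Corner hv) hw using 1
      exact Subtype.ext (by simp [mul_smul, mem_peirce.1 w.2])
    | zero =>
      convert W.zero_mem using 1
      exact Subtype.ext (by simp)
    | add m n _ _ hm hn =>
      convert W.add_mem (hm a) (hn a) using 1
      exact Subtype.ext (by simp)
    | smul b m _ hm =>
      convert hm (a * b) using 1
      exact Subtype.ext (by simp [mul_smul])
  have key (W W' : Submodule (Corner hv) (peirce v M)) (h : S W = S W') : W ≤ W' := by
    intro w hw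
    have hw' : (w : M) ∈ S W' := h ▸ Submodule.subset_span ⟨w, hw, rfl⟩
    convert hS W' hw' 1 using 1
    exact Subtype.ext (by simp [mem_peirce.1 w.2])
  have hmono : StrictMono S := Monotone.strictMono_of_injective
    (fun W W' h => Submodule.span_mono (Set.image_mono h))
    fun W W' h => le_antisymm (key W W' h) (key W' W h.symm)
  exact hmono.wellFoundedGT

end Peirce

/-- The quotient map from `P_λ` to `Δ_λ`. -/
def toDelta {A X : Type} [Ring A] [PartialOrder X] {Λ : X → Type} {f : ∀ x, Λ x → A}
    (lam : Σ x, Λ x) : P A Λ f lam →ₗ[A] Delta A Λ f lam :=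
  Submodule.mkQ _

theorem toDelta_surjective {A X : Type} [Ring A] [PartialOrder X] {Λ : X → Type}
    {f : ∀ x, Λ x → A} (lam : Σ x, Λ x) : Function.Surjective (toDelta (f := f) lam) :=
  Submodule.mkQ_surjective _

theorem HasDeltaFiltration.of_quotient {A X : Type} [Ring A] [PartialOrder X] {Λ : X → Type}
    {f : ∀ x, Λ x → A} {V : Type} [AddCommGroup V] [Module A V] (N : Submodule A V)
    {lam : Σ x, Λ x} (φ : N ≃ₗ[A] Delta A Λ f lam) (hN : HasDeltaFiltration A Λ f (V ⧸ N)) :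
    HasDeltaFiltration A Λ f V := by
  obtain ⟨n, F, hF, hbot, htop, hquot⟩ := hN
  have hzero : (F 0).comap N.mkQ = N := by
    rw [hbot, Submodule.comap_bot, Submodule.ker_mkQ]
  refine ⟨n + 1, Fin.cons ⊥ fun i => (F i).comap N.mkQ, ?_, rfl, ?_, fun i => ?_⟩
  · refine Fin.monotone_iff_le_succ.2 fun i => ?_
    refine Fin.cases ?_ (fun i => ?_) i
    · exact bot_le
    · exact Submodule.comap_mono (hF i.castSucc_lt_succ.le)
  · rw [← Fin.succ_last, Fin.cons_succ, htop, Submodule.comap_top]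
  · refine Fin.cases ?_ (fun i => ?_) i
    · refine ⟨lam, ?_⟩
      rw [Fin.cons_succ, hzero]
      refine ⟨Submodule.quotEquivOfEqBot _ ?_ ≪≫ₗ φ⟩
      exact (Submodule.comap_bot _).trans N.ker_subtype
    · obtain ⟨mu, ⟨ψ⟩⟩ := hquot i
      refine ⟨mu, ?_⟩
      change Nonempty ((((F i.succ).comap N.mkQ) ⧸
        ((F i.castSucc).comap N.mkQ).comap ((F i.succ).comap N.mkQ).subtype) ≃ₗ[A] _)
      let g : (F i.succ).comap N.mkQ →ₗ[A] F i.succ := N.mkQ.restrict fun _ hm => hm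
      have hg : Function.Surjective g := fun ⟨w, hw⟩ => by
        obtain ⟨m, rfl⟩ := N.mkQ_surjective w
        exact ⟨⟨m, hw⟩, rfl⟩
      let r := (Submodule.mkQ ((F i.castSucc).comap (F i.succ).subtype)) ∘ₗ g
      refine ⟨Submodule.quotEquivOfEq _ _ ?_ ≪≫ₗ
        r.quotKerEquivOfSurjective ((Submodule.mkQ_surjective _).comp hg) ≪≫ₗ ψ⟩
      ext m
      rw [LinearMap.mem_ker, LinearMap.comp_apply, Submodule.mkQ_apply,
        Submodule.Quotient.mk_eq_zero]
      rfl

/-- Orthogonal idempotents `e x` with sum `1` whose Peirce components are directed for the order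
on `X`, refined by idempotents `f x i`. -/
structure IsDirectedFamily {A X : Type} [Ring A] [Fintype X] [PartialOrder X] {Λ : X → Type}
    [∀ x, Fintype (Λ x)] (e : X → A) (f : ∀ x, Λ x → A) : Prop where
  idem : ∀ x, e x * e x = e x
  orth : ∀ x y, x ≠ y → e x * e y = 0
  sum_eq_one : ∑ x, e x = 1
  directed : ∀ x y, ¬ x ≤ y → ∀ a, e y * a * e x = 0
  idem_f : ∀ x i, f x i * f x i = f x i
  e_mul_f : ∀ x i, e x * f x i = f x i
  f_mul_e : ∀ x i, f x i * e x = f x i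
  sum_f : ∀ x, ∑ i, f x i = e x

namespace IsDirectedFamily

variable {A X : Type} [Ring A] [Fintype X] [PartialOrder X] {Λ : X → Type}
  [∀ x, Fintype (Λ x)] {e : X → A} {f : ∀ x, Λ x → A}

theorem e_mul_mul_eq (h : IsDirectedFamily e f) {y : X} {p : A} (hp : p * e y = p) (a : A) :
    e y * a * p = e y * a * (e y * p) := by
  have hterm (z : X) (hz : z ≠ y) : e y * a * (e z * p) = 0 := by
    by_cases hzy : z ≤ y
    · rw [← hp, ← mul_assoc (e z), h.directed y z (fun hyz => hz (le_antisymm hzy hyz)), mul_zero]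
    · rw [← mul_assoc, h.directed z y hzy, zero_mul]
  calc e y * a * p = ∑ z, e y * a * (e z * p) := by
        rw [← Finset.mul_sum, ← Finset.sum_mul, h.sum_eq_one, one_mul]
    _ = _ := Fintype.sum_eq_single y hterm

theorem smul_eq_e_mul_smul {M : Type*} [AddCommGroup M] [Module A M] (h : IsDirectedFamily e f)
    {y : X} (hy : ∀ z, y < z → ∀ m : M, e z • m = 0) {m : M} (hm : e y • m = m) (a : A) :
    a • m = (e y * a) • m := by
  have hterm (z : X) (hz : z ≠ y) : (e z * a) • m = 0 := by
    by_cases hyz : y ≤ z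
    · rw [mul_smul, hy z (lt_of_le_of_ne hyz hz.symm)]
    · rw [← hm, smul_smul, h.directed y z hyz, zero_smul]
  calc a • m = ∑ z, (e z * a) • m := by
        rw [← Finset.sum_smul, ← Finset.sum_mul, h.sum_eq_one, one_mul]
    _ = _ := Fintype.sum_eq_single y hterm

theorem mul_f_of_mem_P (h : IsDirectedFamily e f) {lam : Σ x, Λ x} {p : A}
    (hp : p ∈ P A Λ f lam) : p * f lam.1 lam.2 = p := by
  obtain ⟨a, rfl⟩ := Submodule.mem_span_singleton.1 hp
  rw [smul_eq_mul, mul_assoc, h.idem_f]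

theorem mul_e_of_mem_P (h : IsDirectedFamily e f) {lam : Σ x, Λ x} {p : A}
    (hp : p ∈ P A Λ f lam) : p * e lam.1 = p := by
  rw [← h.mul_f_of_mem_P hp, mul_assoc, h.f_mul_e]

/-- The standard module `Δ_λ` is the quotient of `P_λ` by the elements with no component at the
object of `λ`. -/
theorem mem_iSup_trace_iff (h : IsDirectedFamily e f) (lam : Σ x, Λ x) (p : P A Λ f lam) :
    p ∈ (⨆ mu : Σ x, Λ x, ⨆ _ : ¬ mu.1 ≤ lam.1, trace A Λ f mu lam) ↔ e lam.1 * (p : A) = 0 := by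
  constructor
  · let S : Submodule A (P A Λ f lam) :=
      { carrier := {q | e lam.1 * (q : A) = 0}
        zero_mem' := mul_zero _
        add_mem' := fun {q r} hq hr =>
          (mul_add (e lam.1) (q : A) r).trans ((congrArg₂ (· + ·) hq hr).trans (add_zero 0))
        smul_mem' := fun a q hq => by
          change e lam.1 * (a * (q : A)) = 0
          rw [← mul_assoc, h.e_mul_mul_eq (h.mul_e_of_mem_P q.2)]
          exact (congrArg _ hq).trans (mul_zero _) }
    suffices hle : (⨆ mu : Σ x, Λ x, ⨆ _ : ¬ mu.1 ≤ lam.1, trace A Λ f mu lam) ≤ S from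
      fun hp => hle hp
    refine iSup_le fun mu => iSup_le fun hmu => iSup_le fun g => ?_
    rintro _ ⟨q, rfl⟩
    change e lam.1 * (g q : A) = 0
    let w : P A Λ f mu := ⟨f mu.1 mu.2, Submodule.mem_span_singleton_self _⟩
    have hq : q = ((q : A) * f mu.1 mu.2) • w := Subtype.ext (by
      simp [w, h.mul_f_of_mem_P q.2])
    rw [hq, map_smul, Submodule.coe_smul, smul_eq_mul, ← h.e_mul_f, ← mul_assoc, ← mul_assoc,
      ← mul_assoc, h.directed _ _ hmu, zero_mul, zero_mul]
  · intro hp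
    have hsum : p = ∑ z, ∑ j, f z j • p := by
      simp_rw [← Finset.sum_smul, h.sum_f, h.sum_eq_one, one_smul]
    rw [hsum]
    refine Submodule.sum_mem _ fun z _ => Submodule.sum_mem _ fun j _ => ?_
    by_cases hz : z ≤ lam.1
    · suffices e z * (p : A) = 0 by
        convert Submodule.zero_mem _
        refine Subtype.ext ?_
        rw [Submodule.coe_smul, smul_eq_mul, ← h.f_mul_e, mul_assoc, this, mul_zero,
          Submodule.coe_zero]
      by_cases hz' : lam.1 ≤ z
      · rwa [le_antisymm hz hz']
      · rw [← h.mul_e_of_mem_P p.2, ← mul_assoc, h.directed _ _ hz']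
    · refine Submodule.mem_iSup_of_mem ⟨z, j⟩ (Submodule.mem_iSup_of_mem hz
        (Submodule.mem_iSup_of_mem
          ((LinearMap.toSpanSingleton A _ p) ∘ₗ (P A Λ f ⟨z, j⟩).subtype)
          ⟨⟨f z j, Submodule.mem_span_singleton_self _⟩, rfl⟩))

theorem toDelta_eq_zero_iff (h : IsDirectedFamily e f) (lam : Σ x, Λ x) (p : P A Λ f lam) :
    toDelta lam p = 0 ↔ e lam.1 * (p : A) = 0 :=
  (Submodule.Quotient.mk_eq_zero _).trans (h.mem_iSup_trace_iff lam p)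

theorem nonempty_span_equiv_delta {V : Type*} [AddCommGroup V] [Module A V]
    (h : IsDirectedFamily e f) (lam : Σ x, Λ x) (m : V)
    (hann : ∀ p ∈ P A Λ f lam, p • m = 0 ↔ e lam.1 * p = 0) (hm : f lam.1 lam.2 • m = m) :
    Nonempty (Submodule.span A {m} ≃ₗ[A] Delta A Λ f lam) := by
  let g : P A Λ f lam →ₗ[A] V := LinearMap.toSpanSingleton A V m ∘ₗ (P A Λ f lam).subtype
  have hrange : LinearMap.range g = Submodule.span A {m} := by
    ext n
    rw [Submodule.mem_span_singleton]
    constructor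
    · rintro ⟨p, rfl⟩
      exact ⟨p, rfl⟩
    · rintro ⟨a, rfl⟩
      refine ⟨⟨a * f lam.1 lam.2, Submodule.mem_span_singleton.2 ⟨a, rfl⟩⟩, ?_⟩
      simp [g, mul_smul, hm]
  have hker : LinearMap.ker g = LinearMap.ker (toDelta lam) := by
    ext p
    exact (hann p p.2).trans (h.toDelta_eq_zero_iff lam p).symm
  exact hrange ▸ nonempty_range_equiv_of_ker_eq g _ (toDelta_surjective lam) hker

theorem projective_peirce_delta (h : IsDirectedFamily e f) (lam : Σ x, Λ x) (y : X) :
    Module.Projective (Corner (h.idem y)) (peirce (e y) (Delta A Λ f lam)) := by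
  by_cases hy : y = lam.1
  · subst hy
    have hfe : f lam.1 lam.2 ∈ P A Λ f lam := Submodule.mem_span_singleton_self _
    let F : Corner (h.idem lam.1) := Corner.mk (f lam.1 lam.2) (h.e_mul_f _ _) (h.f_mul_e _ _)
    let m : peirce (e lam.1) (Delta A Λ f lam) := ⟨toDelta lam ⟨_, hfe⟩, by
      rw [mem_peirce, ← map_smul]
      exact congrArg _ (Subtype.ext (h.e_mul_f _ _))⟩
    refine projective_of_surjective_of_endomorphism (LinearMap.toSpanSingleton _ _ m) ?_
      (LinearMap.toSpanSingleton _ _ F) (fun b hb => ?_) fun b => ?_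
    · rintro ⟨d, hd⟩
      obtain ⟨p, rfl⟩ := toDelta_surjective lam d
      refine ⟨Corner.mk (e lam.1 * p) (by rw [← mul_assoc, h.idem])
        (by rw [mul_assoc, h.mul_e_of_mem_P p.2]), Subtype.ext ?_⟩
      refine Eq.trans ?_ (mem_peirce.1 hd)
      rw [LinearMap.toSpanSingleton_apply, coe_corner_smul, Corner.val_mk, ← map_smul, ← map_smul]
      refine congrArg _ (Subtype.ext ?_)
      simp [mul_assoc, h.mul_f_of_mem_P p.2]
    · have := congrArg Subtype.val hb
      rw [LinearMap.toSpanSingleton_apply, coe_corner_smul, ← map_smul, ZeroMemClass.coe_zero,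
        h.toDelta_eq_zero_iff, Submodule.coe_smul, smul_eq_mul, ← mul_assoc, b.mul_val] at this
      exact Corner.ext this
    · refine Subtype.ext ?_
      simp only [LinearMap.toSpanSingleton_apply, coe_corner_smul, smul_eq_mul, Corner.val_mul, m,
        ← map_smul]
      refine congrArg _ (Subtype.ext ?_)
      simp [F, mul_assoc, h.idem_f]
  · have : Subsingleton (peirce (e y) (Delta A Λ f lam)) := by
      refine subsingleton_of_forall_eq 0 ?_
      rintro ⟨d, hd⟩
      obtain ⟨p, rfl⟩ := toDelta_surjective lam d
      refine Subtype.ext ((mem_peirce.1 hd).symm.trans ?_)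
      rw [ZeroMemClass.coe_zero, ← map_smul, h.toDelta_eq_zero_iff,
        Submodule.coe_smul, smul_eq_mul, ← mul_assoc, h.orth _ _ (Ne.symm hy), zero_mul]
    infer_instance

theorem projective_peirce_of_hasDeltaFiltration (h : IsDirectedFamily e f) {V : Type}
    [AddCommGroup V] [Module A V] (hV : HasDeltaFiltration A Λ f V) (y : X) :
    Module.Projective (Corner (h.idem y)) (peirce (e y) V) := by
  obtain ⟨n, F, hF, hbot, htop, hquot⟩ := hV
  have key (i : Fin (n + 1)) : Module.Projective (Corner (h.idem y)) (peirce (e y) (F i)) := by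
    induction i using Fin.induction with
    | zero =>
      rw [hbot]
      have : Subsingleton (peirce (e y) (⊥ : Submodule A V)) := Subtype.val_injective.subsingleton
      infer_instance
    | succ i ih =>
      obtain ⟨mu, ⟨φ⟩⟩ := hquot i
      have := h.projective_peirce_delta mu y
      refine projective_peirce_of_exact (h.idem y)
        (Submodule.inclusion (hF i.castSucc_lt_succ.le))
        (φ.toLinearMap ∘ₗ Submodule.mkQ _) (Submodule.inclusion_injective _)
        (φ.surjective.comp (Submodule.mkQ_surjective _)) fun m => ?_
      rw [LinearMap.comp_apply, LinearEquiv.coe_coe, map_eq_zero_iff _ φ.injective,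
        Submodule.mkQ_apply, Submodule.Quotient.mk_eq_zero, Submodule.mem_comap]
      exact ⟨fun hm => ⟨⟨m, hm⟩, rfl⟩, fun ⟨l, hl⟩ => hl ▸ l.2⟩
  have hlast := key (Fin.last n)
  rw [htop] at hlast
  exact Module.Projective.of_split
    (peirceMap (h.idem y) (Submodule.topEquiv (R := A) (M := V)).symm.toLinearMap)
    (peirceMap (h.idem y) Submodule.topEquiv.toLinearMap) (LinearMap.ext fun m => rfl)

theorem exists_delta_submodule (h : IsDirectedFamily e f)
    (hlocal : ∀ x i c, f x i * c = c → c * f x i = c → IsNilpotent c ∨ ∃ d, c * d = f x i)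
    {V : Type} [AddCommGroup V] [Module A V] [IsNoetherian A V] [Nontrivial V]
    (hV : ∀ y, Module.Projective (Corner (h.idem y)) (peirce (e y) V)) :
    ∃ (lam : Σ x, Λ x) (N : Submodule A V), N ≠ ⊥ ∧ Nonempty (N ≃ₗ[A] Delta A Λ f lam) ∧
      ∀ y, Module.Projective (Corner (h.idem y)) (peirce (e y) (V ⧸ N)) := by
  have hne : {z | ∃ m : V, e z • m ≠ 0}.Nonempty := by
    by_contra hempty
    obtain ⟨m, hm⟩ := exists_ne (0 : V)
    refine hm ?_
    rw [← one_smul A m, ← h.sum_eq_one, Finset.sum_smul]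
    refine Finset.sum_eq_zero fun z _ => ?_
    by_contra hz
    exact hempty ⟨z, m, hz⟩
  obtain ⟨y, ⟨m₀, hm₀⟩, hmax⟩ := (Set.toFinite {z | ∃ m : V, e z • m ≠ 0}).exists_maximal hne
  have hy (z : X) (hz : y < z) (m : V) : e z • m = 0 := by
    by_contra hne
    exact hz.not_ge (hmax ⟨m, hne⟩ hz.le)
  have : Nontrivial (peirce (e y) V) :=
    ⟨⟨⟨e y • m₀, smul_mem_peirce (h.idem y) m₀⟩, 0, fun h0 => hm₀ (congrArg Subtype.val h0)⟩⟩
  have := hV y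
  let F (i : Λ y) : Corner (h.idem y) := Corner.mk (f y i) (h.e_mul_f _ _) (h.f_mul_e _ _)
  have hFlocal (i : Λ y) (c : Corner (h.idem y)) (hl : F i * c = c) (hr : c * F i = c) :
      IsNilpotent c ∨ ∃ d, c * d = F i := by
    refine (hlocal y i c.val (congrArg Corner.val hl) (congrArg Corner.val hr)).imp ?_ ?_
    · rintro ⟨n, hn⟩
      exact ⟨n + 1, Corner.ext (by rw [Corner.val_pow_succ, pow_succ, hn, zero_mul]; rfl)⟩
    · rintro ⟨d, hd⟩
      refine ⟨Corner.mk (e y * d * e y) (by simp only [← mul_assoc, h.idem])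
        (by simp only [mul_assoc, h.idem]), Corner.ext ?_⟩
      rw [Corner.val_mul, Corner.val_mk, ← mul_assoc, ← mul_assoc, c.val_mul_right, hd]
      exact h.f_mul_e y i
  obtain ⟨i, ⟨m, hmy⟩, φ, hm0, hφ, hFm⟩ := exists_apply_eq_idempotent (Q := peirce (e y) V) F
    (fun i => Corner.ext (h.idem_f y i))
    (Corner.ext (by rw [Corner.val_sum]; exact h.sum_f y)) hFlocal
  have hem : e y • m = m := hmy
  have hfm : f y i • m = m := congrArg Subtype.val hFm
  have hsmul (a : A) : a • m = (e y * a) • m := h.smul_eq_e_mul_smul hy hem a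
  refine ⟨⟨y, i⟩, Submodule.span A {m}, ?_, h.nonempty_span_equiv_delta ⟨y, i⟩ m ?_ hfm, ?_⟩
  · rw [Ne, Submodule.span_singleton_eq_bot]
    exact fun h0 => hm0 (Subtype.ext h0)
  · refine fun p hp => ⟨fun h0 => ?_, fun h0 => by rw [hsmul, h0, zero_smul]⟩
    let b : Corner (h.idem y) := Corner.mk (e y * p) (by rw [← mul_assoc, h.idem])
      (by rw [mul_assoc, h.mul_e_of_mem_P hp])
    have hb : b • (⟨m, hmy⟩ : peirce (e y) V) = 0 := Subtype.ext ((hsmul p).symm.trans h0)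
    have := congrArg (fun q => (φ q).val) hb
    simp only [map_smul, hφ, map_zero, smul_eq_mul, Corner.val_mul, Corner.val_zero] at this
    rwa [Corner.val_mk, Corner.val_mk, mul_assoc, h.mul_f_of_mem_P hp] at this
  · intro z
    have := hV z
    have hmem {q : peirce (e z) V} (hq : peirceMap (h.idem z) (Submodule.span A {m}).mkQ q = 0) :
        ∃ a : A, a • m = q :=
      Submodule.mem_span_singleton.1 ((Submodule.Quotient.mk_eq_zero _).1 (congrArg Subtype.val hq))
    have hsurj := peirceMap_surjective (h.idem z) (Submodule.span A {m}).mkQ_surjective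
    by_cases hz : z = y
    · subst hz
      refine projective_of_surjective_of_endomorphism _ hsurj
        (LinearMap.id - LinearMap.toSpanSingleton _ _ ⟨m, hmy⟩ ∘ₗ φ) (fun q hq => ?_) fun q => ?_
      · obtain ⟨a, ha⟩ := hmem hq
        let b : Corner (h.idem z) := Corner.mk (e z * a * e z) (by simp only [← mul_assoc, h.idem])
          (by simp only [mul_assoc, h.idem])
        have hb : q = b • (⟨m, hmy⟩ : peirce (e z) V) := Subtype.ext (by
          rw [coe_corner_smul, Corner.val_mk, mul_smul, hem, ← hsmul, ha])
        rw [LinearMap.sub_apply, LinearMap.id_apply, LinearMap.comp_apply,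
          LinearMap.toSpanSingleton_apply, hb, map_smul, hφ, smul_assoc, hFm, sub_self]
      · rw [LinearMap.sub_apply, map_sub, LinearMap.id_apply, sub_eq_self]
        refine Subtype.ext ((Submodule.Quotient.mk_eq_zero _).2 ?_)
        exact Submodule.smul_mem _ _ (Submodule.mem_span_singleton_self m)
    · refine projective_of_surjective_of_endomorphism _ hsurj LinearMap.id (fun q hq => ?_)
        fun q => rfl
      obtain ⟨a, ha⟩ := hmem hq
      refine Subtype.ext ?_
      change (q : V) = 0
      rw [← mem_peirce.1 q.2, ← ha, hsmul, smul_smul, ← mul_assoc, h.orth z y hz, zero_mul,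
        zero_smul]

theorem hasDeltaFiltration_of_projective_peirce (h : IsDirectedFamily e f)
    (hlocal : ∀ x i c, f x i * c = c → c * f x i = c → IsNilpotent c ∨ ∃ d, c * d = f x i)
    (V : Type) [AddCommGroup V] [Module A V] [IsNoetherian A V] [IsArtinian A V]
    (hV : ∀ y, Module.Projective (Corner (h.idem y)) (peirce (e y) V)) :
    HasDeltaFiltration A Λ f V := by
  induction hn : Module.length A V using WellFoundedLT.induction generalizing V with
  | ind n ih =>
    cases subsingleton_or_nontrivial V with
    | inl hsub =>
      exact ⟨0, fun _ => ⊥, monotone_const, rfl, Subsingleton.elim _ _, fun i => i.elim0⟩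
    | inr hnontriv =>
      obtain ⟨lam, N, hN, ⟨φ⟩, hproj⟩ := h.exists_delta_submodule hlocal hV
      exact HasDeltaFiltration.of_quotient N φ
        (ih _ (hn ▸ Submodule.length_quotient_lt N hN) (V ⧸ N) hproj rfl)

theorem homSpIsProjective_iff (h : IsDirectedFamily e f) (x y : X) :
    HomSpIsProjective (e x) (e y) (h.idem y) ↔
      ∀ i, Module.Projective (Corner (h.idem y)) (peirce (e y) (P A Λ f ⟨x, i⟩)) := by
  classical
  change Module.Projective (Corner (h.idem y)) (HomSp (e x) (e y)) ↔ _
  let π (i : Λ x) : HomSp (e x) (e y) →ₗ[Corner (h.idem y)] peirce (e y) (P A Λ f ⟨x, i⟩) :=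
    { toFun := fun a => ⟨⟨a.1 * f x i, Submodule.mem_span_singleton.2 ⟨_, rfl⟩⟩,
        Subtype.ext (by simp [← mul_assoc, a.2.1])⟩
      map_add' := fun a b => Subtype.ext (Subtype.ext (add_mul a.1 b.1 _))
      map_smul' := fun b a => Subtype.ext (Subtype.ext (mul_assoc b.val a.1 _)) }
  let ι (i : Λ x) : peirce (e y) (P A Λ f ⟨x, i⟩) →ₗ[Corner (h.idem y)] HomSp (e x) (e y) :=
    { toFun := fun p => ⟨p.1.1, congrArg Subtype.val (mem_peirce.1 p.2), h.mul_e_of_mem_P p.1.2⟩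
      map_add' := fun p q => rfl
      map_smul' := fun b p => rfl }
  constructor
  · intro hproj i
    refine Module.Projective.of_split (ι i) (π i) (LinearMap.ext fun p => ?_)
    exact Subtype.ext (Subtype.ext (h.mul_f_of_mem_P p.1.2))
  · intro hproj
    have : Module.Projective (Corner (h.idem y)) (∀ i, peirce (e y) (P A Λ f ⟨x, i⟩)) :=
      .of_equiv' (DFinsupp.linearEquivFunOnFintype (R := Corner (h.idem y)))
    refine Module.Projective.of_split (LinearMap.pi π) (∑ i, ι i ∘ₗ LinearMap.proj i)
      (LinearMap.ext fun a => ?_)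
    have hval (s : Finset (Λ x)) (b : Λ x → HomSp (e x) (e y)) :
        (∑ i ∈ s, b i).1 = ∑ i ∈ s, (b i).1 :=
      map_sum (⟨⟨Subtype.val, rfl⟩, fun _ _ => rfl⟩ : HomSp (e x) (e y) →+ A) b s
    refine Subtype.ext ?_
    rw [LinearMap.comp_apply, LinearMap.sum_apply, hval]
    calc ∑ i, a.1 * f x i = a.1 * e x := by rw [← Finset.mul_sum, h.sum_f]
      _ = a.1 := a.2.2

end IsDirectedFamily

end Stmt16

open Stmt16 in
/-- let `C` be a directed `k`-linear category with respect to a partial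
order `≤` on its (finitely many) objects, presented by its associated finite-dimensional
algebra `A` with complete family of orthogonal idempotents `e x`, hom-spaces
`C(x,y) = e y · A · e x`, and a complete family `f x i` of orthogonal primitive
idempotents refining `e x`.  Then `C` is standardly stratified for the canonical
pre-order induced by `≤` if and only if `C(x,y)` is a projective `C(y,y)`-module for
every pair of objects `x, y`. -/
theorem stmt16 (k : Type) [Field k] (A : Type) [Ring A] [Algebra k A]
    [FiniteDimensional k A]
    (X : Type) [Fintype X] [DecidableEq X] [PartialOrder X]
    (e : X → A)
    (hidem : ∀ x, e x * e x = e x)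
    (horth : ∀ x y, x ≠ y → e x * e y = 0)
    (hsum : ∑ x, e x = 1)
    (hdirected : ∀ x y : X, (∃ a : A, e y * a * e x ≠ 0) → x ≤ y)
    (Λ : X → Type) [∀ x, Fintype (Λ x)] [∀ x, DecidableEq (Λ x)]
    (f : ∀ x, Λ x → A)
    (hprim : ∀ (x : X) (i : Λ x), IsPrimitiveIdem (f x i))
    (forth : ∀ (x : X) (i : Λ x) (y : X) (j : Λ y),
      (⟨x, i⟩ : Σ x, Λ x) ≠ ⟨y, j⟩ → f x i * f y j = 0)
    (hcompl : ∀ x : X, ∑ i, f x i = e x) :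
    StandardlyStratified A Λ f ↔
      ∀ x y : X, HomSpIsProjective (e x) (e y) (hidem y) := by
  have hfe (x : X) (i : Λ x) : f x i * e x = f x i := by
    rw [← hcompl, Finset.mul_sum,
      Fintype.sum_eq_single i fun j hj => forth x i x j (by simpa using hj.symm)]
    exact (hprim x i).2.1
  have hef (x : X) (i : Λ x) : e x * f x i = f x i := by
    rw [← hcompl, Finset.sum_mul,
      Fintype.sum_eq_single i fun j hj => forth x j x i (by simpa using hj)]
    exact (hprim x i).2.1
  have h : IsDirectedFamily e f :=
    { idem := hidem
      orth := horth
      sum_eq_one := hsum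
      directed := fun x y hxy a => by_contra fun hne => hxy (hdirected x y ⟨a, hne⟩)
      idem_f := fun x i => (hprim x i).2.1
      e_mul_f := hef
      f_mul_e := hfe
      sum_f := hcompl }
  have : IsNoetherianRing A := isNoetherian_of_tower k inferInstance
  have : IsArtinianRing A := isArtinian_of_tower k inferInstance
  simp_rw [h.homSpIsProjective_iff]
  constructor
  · exact fun hstrat x y i => h.projective_peirce_of_hasDeltaFiltration (hstrat ⟨x, i⟩) y
  · exact fun hproj lam => h.hasDeltaFiltration_of_projective_peirce
      (fun x i c => (hprim x i).isNilpotent_or_exists_mul_eq (k := k)) _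
      fun y => hproj lam.1 y lam.2
end

section
/- Let E be a finite free EI category and α: x → y an unfactorizable morphism. Let H = Aut_E(y) and H_0 = Stab_H(α). If |H_0| is invertible in k, then the cyclic left kE-module kE·α is projective; indeed kE·α ≅ kE·e where e = (1/|H_0|) Σ_{h ∈ H_0} h. -/
open CategoryTheory

namespace EICat

variable {E : Type} [Category E]

/-- A morphism is unfactorizable if it is not an isomorphism and in any factorization
one of the two factors is an isomorphism. -/
def Unfactorizable {x y : E} (f : x ⟶ y) : Prop :=
  ¬ IsIso f ∧ ∀ (z : E) (u : x ⟶ z) (v : z ⟶ y), u ≫ v = f → IsIso u ∨ IsIso v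

/-- The composite of a chain of composable morphisms. -/
def compChain : (n : ℕ) → (obj : Fin (n + 1) → E) →
    (mor : ∀ i : Fin n, obj i.castSucc ⟶ obj i.succ) → (obj 0 ⟶ obj (Fin.last n))
  | 0, _, _ => 𝟙 _
  | n + 1, obj, mor =>
      mor 0 ≫ compChain n (fun i => obj i.succ)
        (fun i => eqToHom (congrArg obj (Fin.succ_castSucc i)) ≫ mor i.succ)

/-- A decomposition of a morphism `f` into unfactorizable morphisms. -/
structure Decomp {x y : E} (f : x ⟶ y) where
  n : ℕ
  obj : Fin (n + 1) → E
  h0 : obj 0 = x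
  hl : obj (Fin.last n) = y
  mor : ∀ i : Fin n, obj i.castSucc ⟶ obj i.succ
  unfact : ∀ i, Unfactorizable (mor i)
  comp : compChain n obj mor = eqToHom h0 ≫ f ≫ eqToHom hl.symm

/-- The Unique Factorization Property: any two decompositions of a non-isomorphism into
unfactorizable morphisms have the same length, pass through the same objects, and
differ by automorphisms at the intermediate objects. -/
def HasUFP (E : Type) [Category E] : Prop :=
  ∀ {x y : E} (f : x ⟶ y), ¬ IsIso f →
    ∀ D D' : Decomp f,
      ∃ (hn : D.n = D'.n)
        (hobj : ∀ i : Fin (D.n + 1),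
          D.obj i = D'.obj (Fin.cast (congrArg (· + 1) hn) i))
        (h : ∀ i : Fin (D.n + 1), D.obj i ⟶ D.obj i),
        (∀ i, IsIso (h i)) ∧ h 0 = 𝟙 _ ∧ h (Fin.last D.n) = 𝟙 _ ∧
        ∀ i : Fin D.n,
          D.mor i ≫ h i.succ =
            h i.castSucc ≫ eqToHom (hobj i.castSucc) ≫
              eqToHom (congrArg D'.obj (by apply Fin.ext; rfl)) ≫
              D'.mor (Fin.cast hn i) ≫
              eqToHom (congrArg D'.obj (by apply Fin.ext; rfl) :
                D'.obj (Fin.cast hn i).succ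
                  = D'.obj (Fin.cast (congrArg (· + 1) hn) i.succ)).symm ≫
              eqToHom (hobj i.succ).symm

/-- `E` is a finite free EI category. -/
def IsFiniteFreeEI (E : Type) [Category E] : Prop :=
  Finite E ∧ (∀ x y : E, Finite (x ⟶ y)) ∧ (∀ (x : E) (f : x ⟶ x), IsIso f) ∧ HasUFP E

section Algebra

variable (k : Type) [Field k] (AA : Type) [Ring AA] [Algebra k AA]

open scoped Classical in
/-- `(AA, b)` is (a copy of) the category algebra `kE`: a `k`-algebra with basis the
morphisms of `E`, with convolution product and identity the sum of identities. -/
def IsCategoryAlgebra (b : (Σ x y : E, x ⟶ y) → AA) : Prop :=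
  LinearIndependent k b ∧ Submodule.span k (Set.range b) = ⊤ ∧
  (∀ (x y z w : E) (f : x ⟶ y) (g : z ⟶ w),
    b ⟨z, w, g⟩ * b ⟨x, y, f⟩ =
      if h : y = z then b ⟨x, w, f ≫ eqToHom h ≫ g⟩ else 0) ∧
  (1 : AA) = ∑ᶠ x : E, b ⟨x, x, 𝟙 x⟩

end Algebra

end EICat

namespace EICat

section Combinatorics

variable {E : Type} [Category E]

theorem compChain_naturality (n : ℕ) (obj : Fin (n + 1) → E)
    (mor mor' : ∀ i : Fin n, obj i.castSucc ⟶ obj i.succ) (h : ∀ i, obj i ⟶ obj i)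
    (nat : ∀ i, mor i ≫ h i.succ = h i.castSucc ≫ mor' i) :
    compChain n obj mor ≫ h (Fin.last n) = h 0 ≫ compChain n obj mor' := by
  induction n with
  | zero => simp [compChain]
  | succ n ih =>
    have key := ih (fun i => obj i.succ)
      (fun i => eqToHom (congrArg obj (Fin.succ_castSucc i)) ≫ mor i.succ)
      (fun i => eqToHom (congrArg obj (Fin.succ_castSucc i)) ≫ mor' i.succ)
      (fun i => h i.succ) (fun i => by simpa using nat i.succ)
    have nat0 : mor 0 ≫ h (Fin.succ 0) = h 0 ≫ mor' 0 := nat 0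
    let c := compChain n (fun i => obj i.succ)
      (fun i => eqToHom (congrArg obj (Fin.succ_castSucc i)) ≫ mor' i.succ)
    exact (Category.assoc _ _ _).trans <| (congrArg (mor 0 ≫ ·) key).trans <|
      (Category.assoc _ _ _).symm.trans <| (congrArg (· ≫ c) nat0).trans <|
      Category.assoc _ _ _

theorem Unfactorizable.comp_isIso {x y z : E} {f : x ⟶ y} (hf : Unfactorizable f)
    (g : y ⟶ z) [IsIso g] : Unfactorizable (f ≫ g) := by
  refine ⟨fun h => hf.1 (IsIso.of_isIso_comp_right f g), fun w u v huv => ?_⟩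
  have : u ≫ v ≫ inv g = f := by rw [← Category.assoc, huv]; simp
  rcases hf.2 w u _ this with h | h
  · exact .inl h
  · exact .inr (IsIso.of_isIso_comp_right v (inv g))

/-- The empty decomposition of an identity. -/
def Decomp.nil (x : E) : Decomp (𝟙 x) where
  n := 0
  obj := fun _ => x
  h0 := rfl
  hl := rfl
  mor := fun i => i.elim0
  unfact := fun i => i.elim0
  comp := by simp [compChain]

/-- Prepend an unfactorizable morphism to a decomposition. -/
def Decomp.cons {x y z : E} {a : x ⟶ y} (ha : Unfactorizable a) {b : y ⟶ z} (D : Decomp b)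
    {f : x ⟶ z} (hf : a ≫ b = f) : Decomp f where
  n := D.n + 1
  obj := Fin.cons x D.obj
  h0 := rfl
  hl := D.hl
  mor := Fin.cases (a ≫ eqToHom D.h0.symm) D.mor
  unfact := Fin.cases (ha.comp_isIso (eqToHom D.h0.symm : y ⟶ D.obj 0)) D.unfact
  comp := by
    have h : compChain D.n D.obj (fun i => eqToHom rfl ≫ D.mor i) =
        eqToHom D.h0 ≫ b ≫ eqToHom D.hl.symm := by
      simpa using D.comp
    change (a ≫ eqToHom D.h0.symm) ≫ compChain D.n D.obj (fun i => eqToHom rfl ≫ D.mor i) = _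
    rw [h, ← hf]
    simp only [Category.assoc, eqToHom_trans_assoc, eqToHom_refl, Category.id_comp]
    exact (Category.id_comp _).symm

theorem isIso_of_map_back (hE : ∀ (x : E) (f : x ⟶ x), IsIso f) {x y : E} (f : x ⟶ y)
    (g : y ⟶ x) : IsIso f := by
  have := hE _ (f ≫ g)
  have := hE _ (g ≫ f)
  have : IsSplitMono f := ⟨⟨⟨g ≫ inv (f ≫ g), by rw [← Category.assoc]; simp⟩⟩⟩
  have : Epi f := epi_of_epi g f
  exact isIso_of_epi_of_isSplitMono f

theorem exists_unfactorizable_comp [Finite E] (hE : ∀ (x : E) (f : x ⟶ x), IsIso f) {x y : E}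
    (f : x ⟶ y) (hf : ¬ IsIso f) :
    ∃ (z : E) (a : x ⟶ z) (b : z ⟶ y), Unfactorizable a ∧ a ≫ b = f := by
  let r : E → E → Prop := fun v w => Nonempty (v ⟶ w) ∧ ¬ Nonempty (w ⟶ v)
  have : IsTrans E r := ⟨fun _ _ _ ⟨⟨p⟩, hp⟩ ⟨⟨q⟩, _⟩ => ⟨⟨p ≫ q⟩, fun ⟨s⟩ => hp ⟨q ≫ s⟩⟩⟩
  have : Std.Irrefl r := ⟨fun _ h => h.2 h.1⟩
  induction y using (Finite.wellFounded_of_trans_of_irrefl r).induction with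
  | _ y ih =>
  by_cases h : Unfactorizable f
  · exact ⟨y, f, 𝟙 y, h, by simp⟩
  · simp only [Unfactorizable, hf, not_false_eq_true, true_and, not_forall, not_or] at h
    obtain ⟨z, u, v, huv, hu, hv⟩ := h
    obtain ⟨w, a, b, ha, hab⟩ := ih z ⟨⟨v⟩, fun ⟨s⟩ => hv (isIso_of_map_back hE v s)⟩ u hu
    exact ⟨w, a, b ≫ v, ha, by rw [← Category.assoc, hab, huv]⟩

theorem nonempty_decomp [Finite E] (hE : ∀ (x : E) (f : x ⟶ x), IsIso f) {x y : E}
    (f : x ⟶ y) (hf : ¬ IsIso f) : Nonempty (Decomp f) := by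
  let r : E → E → Prop := fun v w => Nonempty (w ⟶ v) ∧ ¬ Nonempty (v ⟶ w)
  have : IsTrans E r := ⟨fun _ _ _ ⟨⟨p⟩, hp⟩ ⟨⟨q⟩, _⟩ => ⟨⟨q ≫ p⟩, fun ⟨s⟩ => hp ⟨s ≫ q⟩⟩⟩
  have : Std.Irrefl r := ⟨fun _ h => h.2 h.1⟩
  induction x using (Finite.wellFounded_of_trans_of_irrefl r).induction with
  | _ x ih =>
  obtain ⟨z, a, b, ha, hab⟩ := exists_unfactorizable_comp hE f hf
  by_cases hb : IsIso b
  · have hu : Unfactorizable f := hab ▸ ha.comp_isIso b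
    exact ⟨.cons hu (.nil y) (Category.comp_id f)⟩
  · obtain ⟨D⟩ := ih z ⟨⟨a⟩, fun ⟨s⟩ => ha.1 (isIso_of_map_back hE a s)⟩ b hb
    exact ⟨.cons ha D hab⟩

theorem exists_stabilizer_of_decomp (hufp : HasUFP E) {x y z : E} {α : x ⟶ y}
    (hα : Unfactorizable α) {u v : y ⟶ z} (hf : ¬ IsIso (α ≫ u)) (huv : α ≫ u = α ≫ v)
    (D : Decomp u) (D' : Decomp v) : ∃ h : y ⟶ y, α ≫ h = α ∧ h ≫ v = u := by
  obtain ⟨hn, hobj, h, -, h0, hl, nat⟩ := hufp _ hf (.cons hα D rfl) (.cons hα D' huv.symm)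
  obtain ⟨n, obj, rfl, rfl, mor, unf, comp⟩ := D
  obtain ⟨n', obj', e0, el, mor', unf', comp'⟩ := D'
  obtain rfl : n = n' := Nat.succ_injective hn
  obtain rfl : obj = obj' := funext fun i => hobj i.succ
  let t : ∀ i : Fin (n + 1), obj i ⟶ obj i := fun i => h (Fin.succ i)
  have ht0 : (α ≫ 𝟙 _) ≫ t 0 = 𝟙 x ≫ 𝟙 _ ≫ 𝟙 _ ≫ (α ≫ 𝟙 _) ≫ 𝟙 _ ≫ 𝟙 _ :=
    (nat (0 : Fin (n + 1))).trans (congrArg (· ≫ _) h0)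
  have htl : t (Fin.last n) = 𝟙 _ := hl
  have ht (i : Fin n) : mor i ≫ t i.succ =
      t i.castSucc ≫ 𝟙 _ ≫ 𝟙 _ ≫ mor' i ≫ 𝟙 _ ≫ 𝟙 _ := nat i.succ
  refine ⟨t 0, by simpa using ht0, ?_⟩
  have key := compChain_naturality n obj mor mor' t fun i => by simpa using ht i
  rw [htl, comp, comp'] at key
  simpa using key.symm

/-- Two morphisms agreeing after precomposition with an unfactorizable `α` differ by an
element of the stabilizer of `α`. -/
theorem exists_stabilizer_of_comp_eq (hEI : IsFiniteFreeEI E) {x y z : E} {α : x ⟶ y}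
    (hα : Unfactorizable α) {u v : y ⟶ z} (huv : α ≫ u = α ≫ v) :
    ∃ h : y ⟶ y, α ≫ h = α ∧ h ≫ v = u := by
  obtain ⟨_, -, hE, hufp⟩ := hEI
  by_cases hv : IsIso v
  · exact ⟨u ≫ inv v, by rw [← Category.assoc, huv]; simp, by simp⟩
  by_cases hu : IsIso u
  · exact (hv (isIso_of_map_back hE v (inv u))).elim
  obtain ⟨D⟩ := nonempty_decomp hE u hu
  obtain ⟨D'⟩ := nonempty_decomp hE v hv
  refine exists_stabilizer_of_decomp hufp hα (fun h => ?_) huv D D'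
  exact hα.1 (isIso_of_map_back hE α (u ≫ inv (α ≫ u)))

end Combinatorics

section Modules

variable {R : Type*} [Ring R]

theorem projective_span_singleton_of_isIdempotentElem {e : R} (he : IsIdempotentElem e) :
    Module.Projective R ↥(Submodule.span R {e}) := by
  refine Module.Projective.of_split (Submodule.span R {e}).subtype
    ((LinearMap.toSpanSingleton R R e).codRestrict _ fun r =>
      Submodule.mem_span_singleton.2 ⟨r, rfl⟩) ?_
  ext ⟨m, hm⟩
  obtain ⟨r, rfl⟩ := Submodule.mem_span_singleton.1 hm
  simp [mul_assoc, he.eq]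

/-- Elements with the same left annihilator generate isomorphic cyclic left modules. -/
theorem nonempty_span_singleton_linearEquiv {e a : R}
    (h : ∀ r, r * a = 0 ↔ r * e = 0) :
    Nonempty (↥(Submodule.span R {a}) ≃ₗ[R] ↥(Submodule.span R {e})) := by
  have hker : LinearMap.ker (LinearMap.toSpanSingleton R R a) =
      LinearMap.ker (LinearMap.toSpanSingleton R R e) := by
    ext r; simpa using h r
  rw [← LinearMap.range_toSpanSingleton, ← LinearMap.range_toSpanSingleton]
  exact ⟨(LinearMap.quotKerEquivRange _).symm ≪≫ₗ Submodule.quotEquivOfEq _ _ hker ≪≫ₗ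
    LinearMap.quotKerEquivRange _⟩

end Modules

section StabilizerIdempotent

variable {k : Type} [Field k] {E : Type} [Category E] {AA : Type} [Ring AA] [Algebra k AA]
  {b : (Σ x y : E, x ⟶ y) → AA}

theorem IsCategoryAlgebra.mul_of_comp (hb : IsCategoryAlgebra k AA b) {x y z : E} (f : x ⟶ y)
    (g : y ⟶ z) : b ⟨y, z, g⟩ * b ⟨x, y, f⟩ = b ⟨x, z, f ≫ g⟩ := by
  rw [hb.2.2.1]; simp

theorem IsCategoryAlgebra.mul_of_ne (hb : IsCategoryAlgebra k AA b) {x y z w : E} (f : x ⟶ y)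
    (g : z ⟶ w) (h : y ≠ z) : b ⟨z, w, g⟩ * b ⟨x, y, f⟩ = 0 := by
  rw [hb.2.2.1, dif_neg h]

variable (k b) in
/-- The average of the stabilizer of `α` in the category algebra. -/
noncomputable def stabAverage {x y : E} (α : x ⟶ y) : AA :=
  (Nat.card {h : y ⟶ y // α ≫ h = α} : k)⁻¹ •
    ∑ᶠ h : {h : y ⟶ y // α ≫ h = α}, b ⟨y, y, h.1⟩

variable {x y : E} {α : x ⟶ y}

theorem stabAverage_mul_eq [Finite (y ⟶ y)]
    (hcard : (Nat.card {h : y ⟶ y // α ≫ h = α} : k) ≠ 0) {m : AA}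
    (hm : ∀ h : y ⟶ y, α ≫ h = α → b ⟨y, y, h⟩ * m = m) : stabAverage k b α * m = m := by
  have := Fintype.ofFinite {h : y ⟶ y // α ≫ h = α}
  rw [stabAverage, finsum_eq_sum_of_fintype, smul_mul_assoc, Finset.sum_mul,
    Finset.sum_congr rfl fun h _ => hm h.1 h.2, Finset.sum_const, Finset.card_univ,
    ← Nat.card_eq_fintype_card, ← Nat.cast_smul_eq_nsmul k, smul_smul, inv_mul_cancel₀ hcard,
    one_smul]

theorem mul_stabAverage [Finite (y ⟶ y)] (hE : ∀ f : y ⟶ y, IsIso f)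
    (hb : IsCategoryAlgebra k AA b) (h : y ⟶ y) (hh : α ≫ h = α) :
    b ⟨y, y, h⟩ * stabAverage k b α = stabAverage k b α := by
  have := Fintype.ofFinite {h : y ⟶ y // α ≫ h = α}
  rw [stabAverage, finsum_eq_sum_of_fintype, mul_smul_comm, Finset.mul_sum]
  congr 1
  simp only [hb.mul_of_comp]
  have := hE h
  let t : {h : y ⟶ y // α ≫ h = α} → {h : y ⟶ y // α ≫ h = α} := fun g =>
    ⟨g.1 ≫ h, by rw [← Category.assoc, g.2, hh]⟩
  have ht : Function.Injective t := fun g g' hg =>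
    Subtype.ext ((cancel_mono h).1 (congrArg Subtype.val hg))
  exact (Finite.injective_iff_bijective.1 ht).sum_comp fun g => b ⟨y, y, g.1⟩

theorem mul_stabAverage_of_ne [Finite (y ⟶ y)] (hb : IsCategoryAlgebra k AA b) {z w : E}
    (g : z ⟶ w) (hz : y ≠ z) : b ⟨z, w, g⟩ * stabAverage k b α = 0 := by
  have := Fintype.ofFinite {h : y ⟶ y // α ≫ h = α}
  rw [stabAverage, finsum_eq_sum_of_fintype, mul_smul_comm, Finset.mul_sum,
    Finset.sum_eq_zero fun h _ => hb.mul_of_ne h.1 g hz, smul_zero]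

open scoped Classical in
theorem exists_linearMap_mul_stabAverage (hEI : IsFiniteFreeEI E)
    (hb : IsCategoryAlgebra k AA b) (hα : Unfactorizable α) :
    ∃ ψ : AA →ₗ[k] AA, ∀ r, ψ (r * b ⟨x, y, α⟩) = r * stabAverage k b α := by
  have := hEI.2.1 y y
  let B : Module.Basis (Σ x y : E, x ⟶ y) k AA := .mk hb.1 hb.2.1.ge
  let F : (Σ x y : E, x ⟶ y) → AA := fun s =>
    if h : ∃ u : y ⟶ s.2.1, α ≫ u ≍ s.2.2 ∧ x = s.1 then
      b ⟨y, s.2.1, h.choose⟩ * stabAverage k b α else 0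
  have hF : ∀ (z : E) (u : y ⟶ z), F ⟨x, z, α ≫ u⟩ = b ⟨y, z, u⟩ * stabAverage k b α := by
    intro z u
    have hex : ∃ v : y ⟶ z, α ≫ v ≍ α ≫ u ∧ x = x := ⟨u, HEq.rfl, rfl⟩
    obtain ⟨h, hh, hu⟩ := exists_stabilizer_of_comp_eq hEI hα
      (eq_of_heq hex.choose_spec.1).symm
    calc F ⟨x, z, α ≫ u⟩ = b ⟨y, z, hex.choose⟩ * stabAverage k b α := dif_pos hex
      _ = b ⟨y, z, u⟩ * stabAverage k b α := by
        conv_rhs => rw [← hu, ← hb.mul_of_comp, mul_assoc,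
          mul_stabAverage (hEI.2.2.1 y) hb h hh]
  refine ⟨B.constr k F, fun r => ?_⟩
  have hB : ∀ s, B.constr k F (b s) = F s := fun s => by
    simpa [B] using B.constr_basis k F s
  suffices B.constr k F ∘ₗ LinearMap.mulRight k (b ⟨x, y, α⟩) =
      LinearMap.mulRight k (stabAverage k b α) from LinearMap.congr_fun this r
  refine B.ext fun ⟨z, w, g⟩ => ?_
  by_cases hz : y = z
  · subst hz
    simp [B, hb.mul_of_comp, hB, hF]
  · simp [B, hb.mul_of_ne α g hz, mul_stabAverage_of_ne hb g hz]

end StabilizerIdempotent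

end EICat

open EICat CategoryTheory in
/-- let `E` be a finite free EI category and `α : x ⟶ y` an
unfactorizable morphism; let `H = Aut_E(y)` (= all endomorphisms of `y`, since `E` is
EI) and `H₀ = Stab_H(α)`.  If `|H₀|` is invertible in `k`, then the cyclic left
`kE`-module `kE·α` is projective; indeed `kE·α ≅ kE·e` for the idempotent
`e = (1/|H₀|) Σ_{h ∈ H₀} h`. -/
theorem stmt18 (k : Type) [Field k] (E : Type) [Category E]
    (hEI : IsFiniteFreeEI E)
    (AA : Type) [Ring AA] [Algebra k AA]
    (b : (Σ x y : E, x ⟶ y) → AA)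
    (hb : IsCategoryAlgebra k AA b)
    (x y : E) (α : x ⟶ y) (hα : Unfactorizable α)
    (hcard : (Nat.card {h : y ⟶ y // α ≫ h = α} : k) ≠ 0) :
    Module.Projective AA ↥(Submodule.span AA {b ⟨x, y, α⟩}) ∧
    Nonempty
      (↥(Submodule.span AA {b ⟨x, y, α⟩}) ≃ₗ[AA]
        ↥(Submodule.span AA
          {(Nat.card {h : y ⟶ y // α ≫ h = α} : k)⁻¹ •
            ∑ᶠ h : {h : y ⟶ y // α ≫ h = α}, b ⟨y, y, h.1⟩})) := by
  have := hEI.2.1 y y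
  obtain ⟨ψ, hψ⟩ := exists_linearMap_mul_stabAverage hEI hb hα
  have hea : stabAverage k b α * b ⟨x, y, α⟩ = b ⟨x, y, α⟩ :=
    stabAverage_mul_eq hcard fun h hh => by rw [hb.mul_of_comp, hh]
  have hee : IsIdempotentElem (stabAverage k b α) :=
    stabAverage_mul_eq hcard (mul_stabAverage (hEI.2.2.1 y) hb)
  obtain ⟨φ⟩ := nonempty_span_singleton_linearEquiv (e := stabAverage k b α)
    (a := b ⟨x, y, α⟩) fun r =>
    ⟨fun h => by rw [← hψ, h, map_zero], fun h => by rw [← hea, ← mul_assoc, h, zero_mul]⟩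
  have := projective_span_singleton_of_isIdempotentElem hee
  exact ⟨.of_equiv φ.symm, ⟨φ⟩⟩
end
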